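/- arXiv:2507.18327 — 2 statements merged into one kernel-verified Lean document; each statement's English description precedes it below -/
import Mathlib

section
/- (Dual certification for MNN-RPCA) Let A be an invertible real n₁×n₁ matrix, λ > 0, and let X₀, S₀ be n₁×n₂ matrices with M = X₀ + S₀, where S₀ has support exactly Ω. Let A X₀ = U Σ Vᵀ be a reduced SVD with U ∈ ℝ^{n₁×r}, V ∈ ℝ^{n₂×r} having orthonormal columns, and let T, P_T, P_{T⊥} be the associated subspace and projections. Assume ‖P_Ω P_T‖ < 1 (operator norm with respect to the Frobenius norm). If there exists a pair (W, F) of n₁×n₂ matrices satisfying P_T(W) = 0, ‖W‖ < 1, P_Ω(F) = 0, ‖F‖_∞ < 1, and Aᵀ U Vᵀ + Aᵀ W = λ (sgn(S₀) + F), then (X₀, S₀) is the unique minimizer of ‖A X‖_* + λ ‖S‖_1 over all pairs (X, S) with X + S = M. -/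
open Matrix BigOperators

attribute [local instance] Classical.propDecidable

noncomputable def nuclearNorm {m n : ℕ} (M : Matrix (Fin m) (Fin n) ℝ) : ℝ :=
  ∑ i, Real.sqrt ((Matrix.isHermitian_conjTranspose_mul_self M).eigenvalues i)

noncomputable def frobNorm {m n : ℕ} (M : Matrix (Fin m) (Fin n) ℝ) : ℝ :=
  Real.sqrt (∑ i, ∑ j, (M i j) ^ 2)

noncomputable def l1Norm {m n : ℕ} (M : Matrix (Fin m) (Fin n) ℝ) : ℝ :=
  ∑ i, ∑ j, |M i j|

noncomputable def supNorm {m n : ℕ} (M : Matrix (Fin m) (Fin n) ℝ) : ℝ :=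
  ⨆ p : Fin m × Fin n, |M p.1 p.2|

noncomputable def specNorm {m n : ℕ} (M : Matrix (Fin m) (Fin n) ℝ) : ℝ :=
  ⨆ i, Real.sqrt ((Matrix.isHermitian_conjTranspose_mul_self M).eigenvalues i)

noncomputable def PΩ {m n : ℕ} (Ω : Finset (Fin m × Fin n)) (M : Matrix (Fin m) (Fin n) ℝ) :
    Matrix (Fin m) (Fin n) ℝ :=
  fun i j => if (i, j) ∈ Ω then M i j else 0

noncomputable def PΩc {m n : ℕ} (Ω : Finset (Fin m × Fin n)) (M : Matrix (Fin m) (Fin n) ℝ) :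
    Matrix (Fin m) (Fin n) ℝ :=
  M - PΩ Ω M

noncomputable def PT {m n r : ℕ} (U : Matrix (Fin m) (Fin r) ℝ) (V : Matrix (Fin n) (Fin r) ℝ)
    (M : Matrix (Fin m) (Fin n) ℝ) : Matrix (Fin m) (Fin n) ℝ :=
  U * Uᵀ * M + M * (V * Vᵀ) - U * Uᵀ * M * (V * Vᵀ)

noncomputable def PTperp {m n r : ℕ} (U : Matrix (Fin m) (Fin r) ℝ) (V : Matrix (Fin n) (Fin r) ℝ)
    (M : Matrix (Fin m) (Fin n) ℝ) : Matrix (Fin m) (Fin n) ℝ :=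
  (1 - U * Uᵀ) * M * (1 - V * Vᵀ)

noncomputable def opNorm {m n : ℕ}
    (L : Matrix (Fin m) (Fin n) ℝ → Matrix (Fin m) (Fin n) ℝ) : ℝ :=
  ⨆ X : {X : Matrix (Fin m) (Fin n) ℝ // frobNorm X ≤ 1}, frobNorm (L X.1)

noncomputable def sgn {m n : ℕ} (S : Matrix (Fin m) (Fin n) ℝ) : Matrix (Fin m) (Fin n) ℝ :=
  fun i j => Real.sign (S i j)

def IsReducedSVD {m n r : ℕ} (X : Matrix (Fin m) (Fin n) ℝ) (U : Matrix (Fin m) (Fin r) ℝ)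
    (S : Matrix (Fin r) (Fin r) ℝ) (V : Matrix (Fin n) (Fin r) ℝ) : Prop :=
  Uᵀ * U = 1 ∧ Vᵀ * V = 1 ∧ S.IsDiag ∧ (∀ i, 0 < S i i) ∧ X = U * S * Vᵀ

def IncoherentUV {m n r : ℕ} (U : Matrix (Fin m) (Fin r) ℝ) (V : Matrix (Fin n) (Fin r) ℝ)
    (μ : ℝ) : Prop :=
  (∀ k, ∑ i, (U k i) ^ 2 ≤ μ * (r : ℝ) / (m : ℝ)) ∧
  (∀ k, ∑ i, (V k i) ^ 2 ≤ μ * (r : ℝ) / (n : ℝ)) ∧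
  ∀ i j, |(U * Vᵀ) i j| ≤ Real.sqrt (μ * (r : ℝ) / ((m : ℝ) * (n : ℝ)))

def HasIncoherentSVD {m n : ℕ} (X : Matrix (Fin m) (Fin n) ℝ) (r : ℕ) (μ : ℝ) : Prop :=
  ∃ (U : Matrix (Fin m) (Fin r) ℝ) (S : Matrix (Fin r) (Fin r) ℝ) (V : Matrix (Fin n) (Fin r) ℝ),
    IsReducedSVD X U S V ∧ IncoherentUV U V μ

def UniqueRPCAMin {n₁ n₂ : ℕ} (A : Matrix (Fin n₁) (Fin n₁) ℝ) (lam : ℝ)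
    (M X₀ S₀ : Matrix (Fin n₁) (Fin n₂) ℝ) : Prop :=
  X₀ + S₀ = M ∧ ∀ X S : Matrix (Fin n₁) (Fin n₂) ℝ, X + S = M → (X, S) ≠ (X₀, S₀) →
    nuclearNorm (A * X₀) + lam * l1Norm S₀ < nuclearNorm (A * X) + lam * l1Norm S

def memT {n₁ n₂ r : ℕ} (U : Matrix (Fin n₁) (Fin r) ℝ) (V : Matrix (Fin n₂) (Fin r) ℝ)
    (M : Matrix (Fin n₁) (Fin n₂) ℝ) : Prop :=
  ∃ (X : Matrix (Fin n₂) (Fin r) ℝ) (Y : Matrix (Fin n₁) (Fin r) ℝ), M = U * Xᵀ + Y * Vᵀ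

noncomputable def berProb (n₁ n₂ : ℕ) (p : ℝ) (E : Finset (Fin n₁ × Fin n₂) → Prop) : ℝ :=
  ∑ Ω : Finset (Fin n₁ × Fin n₂),
    (if E Ω then (1 : ℝ) else 0) * p ^ Ω.card * (1 - p) ^ (n₁ * n₂ - Ω.card)

/-- The Gram matrix of `M` is diagonalized by an orthogonal matrix. -/
lemma exists_orthogonal_gram_diagonalization {m n : ℕ} (M : Matrix (Fin m) (Fin n) ℝ) :
    ∃ Q : Matrix (Fin n) (Fin n) ℝ, Qᵀ * Q = 1 ∧ Q * Qᵀ = 1 ∧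
      Mᵀ * M * Q =
        Q * diagonal (Matrix.isHermitian_conjTranspose_mul_self M).eigenvalues := by
  set h := Matrix.isHermitian_conjTranspose_mul_self M
  have hQ : (h.eigenvectorUnitary : Matrix (Fin n) (Fin n) ℝ)ᵀ * h.eigenvectorUnitary = 1 := by
    have := Unitary.coe_star_mul_self h.eigenvectorUnitary
    rwa [star_eq_conjTranspose, conjTranspose_eq_transpose_of_trivial] at this
  refine ⟨h.eigenvectorUnitary, hQ, mul_eq_one_comm.mp hQ, ?_⟩
  ext i j
  have := congrFun (h.mulVec_eigenvectorBasis j) i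
  rw [mul_diagonal]
  simp only [conjTranspose_eq_transpose_of_trivial] at this
  simpa [mul_apply, mulVec, dotProduct, IsHermitian.eigenvectorUnitary_apply, mul_comm] using this

lemma gram_eigenvalues_nonneg {m n : ℕ} (M : Matrix (Fin m) (Fin n) ℝ) (i : Fin n) :
    0 ≤ (Matrix.isHermitian_conjTranspose_mul_self M).eigenvalues i :=
  (Matrix.posSemidef_conjTranspose_mul_self M).eigenvalues_nonneg i

lemma mulVec_dotProduct_mulVec {m n : ℕ} (M N : Matrix (Fin m) (Fin n) ℝ) (x y : Fin n → ℝ) :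
    (M *ᵥ x) ⬝ᵥ (N *ᵥ y) = x ⬝ᵥ ((Mᵀ * N) *ᵥ y) := by
  rw [← mulVec_mulVec, dotProduct_mulVec x, vecMul_transpose]

/-- A matrix of spectral norm less than one strictly contracts nonzero vectors. -/
lemma mulVec_dotProduct_self_lt {m n : ℕ} {W : Matrix (Fin m) (Fin n) ℝ} (hW : specNorm W < 1)
    {x : Fin n → ℝ} (hx : x ≠ 0) : (W *ᵥ x) ⬝ᵥ (W *ᵥ x) < x ⬝ᵥ x := by
  obtain ⟨Q, hQ, hQ', hd⟩ := exists_orthogonal_gram_diagonalization W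
  set e := (Matrix.isHermitian_conjTranspose_mul_self W).eigenvalues with he
  have hlt : ∀ i, e i < 1 := fun i => by
    have h1 : Real.sqrt (e i) ≤ specNorm W :=
      le_ciSup (f := fun i => Real.sqrt (e i)) (Set.finite_range _).bddAbove i
    have h2 := Real.sq_sqrt (gram_eigenvalues_nonneg W i)
    have h3 := Real.sqrt_nonneg (e i)
    change Real.sqrt (e i) ^ 2 = e i at h2
    nlinarith
  set y := Qᵀ *ᵥ x with hy
  have hxy : x = Q *ᵥ y := by rw [hy, mulVec_mulVec, hQ', one_mulVec]
  have hy0 : y ≠ 0 := fun h => hx (by rw [hxy, h, mulVec_zero])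
  have h1 : x ⬝ᵥ x = ∑ i, y i * y i := by
    rw [hxy, mulVec_dotProduct_mulVec, hQ, one_mulVec]; rfl
  have h2 : (W *ᵥ x) ⬝ᵥ (W *ᵥ x) = ∑ i, y i * (e i * y i) := by
    rw [mulVec_dotProduct_mulVec]
    nth_rw 2 [hxy]
    rw [mulVec_mulVec, hd, hxy, mulVec_dotProduct_mulVec, ← Matrix.mul_assoc, hQ, Matrix.one_mul]
    simp [dotProduct, mulVec_diagonal]
  rw [h1, h2]
  obtain ⟨k, hk⟩ := Function.ne_iff.mp hy0
  refine Finset.sum_lt_sum (fun i _ => ?_) ⟨k, Finset.mem_univ _, ?_⟩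
  · nlinarith [mul_self_nonneg (y i), hlt i]
  · nlinarith [mul_self_pos.mpr hk, hlt k]

/-- Adding to `U * Vᵀ` a strict contraction `W` with `Uᵀ * W = 0` and `W * V = 0` gives a
contraction. -/
lemma certificate_contraction {m n r : ℕ} {U : Matrix (Fin m) (Fin r) ℝ}
    {V : Matrix (Fin n) (Fin r) ℝ} {W : Matrix (Fin m) (Fin n) ℝ} (hU : Uᵀ * U = 1)
    (hV : Vᵀ * V = 1) (hUW : Uᵀ * W = 0) (hWV : W * V = 0) (hW : specNorm W < 1)
    (x : Fin n → ℝ) :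
    ((U * Vᵀ + W) *ᵥ x) ⬝ᵥ ((U * Vᵀ + W) *ᵥ x) ≤ x ⬝ᵥ x ∧
      ((V * Vᵀ) *ᵥ x ≠ x →
        ((U * Vᵀ + W) *ᵥ x) ⬝ᵥ ((U * Vᵀ + W) *ᵥ x) < x ⬝ᵥ x) := by
  have hWU : Wᵀ * U = 0 := by simpa using congrArg transpose hUW
  have hG : (U * Vᵀ + W)ᵀ * (U * Vᵀ + W) = V * Vᵀ + Wᵀ * W := by
    have h1 : V * Uᵀ * (U * Vᵀ) = V * (Uᵀ * U) * Vᵀ := by simp only [Matrix.mul_assoc]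
    have h2 : Wᵀ * (U * Vᵀ) = 0 := by rw [← Matrix.mul_assoc, hWU, Matrix.zero_mul]
    have h3 : V * Uᵀ * W = 0 := by rw [Matrix.mul_assoc, hUW, Matrix.mul_zero]
    rw [transpose_add, transpose_mul, transpose_transpose, Matrix.add_mul, Matrix.mul_add,
      Matrix.mul_add, h1, h2, h3, hU, Matrix.mul_one, add_zero, zero_add]
  have hP : V * Vᵀ * (V * Vᵀ) = V * Vᵀ := by
    rw [Matrix.mul_assoc, ← Matrix.mul_assoc Vᵀ, hV, Matrix.one_mul]
  have hPt : (V * Vᵀ)ᵀ = V * Vᵀ := by simp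
  set y := x - (V * Vᵀ) *ᵥ x with hy
  have hWy : W *ᵥ y = W *ᵥ x := by
    rw [hy, mulVec_sub, mulVec_mulVec, ← Matrix.mul_assoc, hWV]; simp
  have hxx : x ⬝ᵥ x = x ⬝ᵥ ((V * Vᵀ) *ᵥ x) + y ⬝ᵥ y := by
    have h1 := mulVec_dotProduct_mulVec (V * Vᵀ) (V * Vᵀ) x x
    rw [hPt, hP] at h1
    rw [hy, sub_dotProduct, dotProduct_sub, dotProduct_sub, h1,
      dotProduct_comm ((V * Vᵀ) *ᵥ x) x]
    ring
  have hGx : ((U * Vᵀ + W) *ᵥ x) ⬝ᵥ ((U * Vᵀ + W) *ᵥ x) =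
      x ⬝ᵥ ((V * Vᵀ) *ᵥ x) + (W *ᵥ y) ⬝ᵥ (W *ᵥ y) := by
    rw [mulVec_dotProduct_mulVec, hG, add_mulVec, dotProduct_add, hWy,
      mulVec_dotProduct_mulVec W W]
  have hlt : (V * Vᵀ) *ᵥ x ≠ x →
      ((U * Vᵀ + W) *ᵥ x) ⬝ᵥ ((U * Vᵀ + W) *ᵥ x) < x ⬝ᵥ x := fun hne => by
    rw [hGx, hxx]
    exact add_lt_add_right (mulVec_dotProduct_self_lt hW (sub_ne_zero.mpr hne.symm)) _
  refine ⟨?_, hlt⟩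
  by_cases h : (V * Vᵀ) *ᵥ x = x
  · rw [hGx, hxx, show y = 0 by rw [hy, h, sub_self]]; simp
  · exact (hlt h).le

/-- The trace pairing with the certificate `U * Vᵀ + W` is at most the nuclear norm, with equality
only for matrices whose row space is contained in the column space of `V`. -/
lemma trace_certificate_le_nuclearNorm {m n r : ℕ} {U : Matrix (Fin m) (Fin r) ℝ}
    {V : Matrix (Fin n) (Fin r) ℝ} {W : Matrix (Fin m) (Fin n) ℝ} (hU : Uᵀ * U = 1)
    (hV : Vᵀ * V = 1) (hUW : Uᵀ * W = 0) (hWV : W * V = 0) (hW : specNorm W < 1)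
    (Z : Matrix (Fin m) (Fin n) ℝ) :
    trace ((U * Vᵀ + W)ᵀ * Z) ≤ nuclearNorm Z ∧
      (trace ((U * Vᵀ + W)ᵀ * Z) = nuclearNorm Z → Z * (V * Vᵀ) = Z) := by
  obtain ⟨Q, hQ, hQ', hd⟩ := exists_orthogonal_gram_diagonalization Z
  set e := (Matrix.isHermitian_conjTranspose_mul_self Z).eigenvalues with he
  have he0 : ∀ i, 0 ≤ e i := gram_eigenvalues_nonneg Z
  have hcontr := certificate_contraction hU hV hUW hWV hW
  set G := U * Vᵀ + W with hG
  have hcol : ∀ i, Q.col i ⬝ᵥ Q.col i = 1 := fun i => by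
    simpa [mul_apply, dotProduct] using congrFun (congrFun hQ i) i
  have hZQ : ∀ i, (Z *ᵥ Q.col i) ⬝ᵥ (Z *ᵥ Q.col i) = e i := fun i => by
    have h1 : (Zᵀ * Z) *ᵥ Q.col i = e i • Q.col i := by
      ext j
      have := congrFun (congrFun hd j) i
      rw [mul_diagonal] at this
      simpa [mul_apply, mulVec, dotProduct, mul_comm] using this
    rw [mulVec_dotProduct_mulVec, h1, dotProduct_smul, hcol]; simp
  have htr : trace (Gᵀ * Z) = ∑ i, (G *ᵥ Q.col i) ⬝ᵥ (Z *ᵥ Q.col i) := by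
    have h1 : trace (Gᵀ * Z) = trace ((G * Q)ᵀ * (Z * Q)) := by
      rw [transpose_mul, Matrix.mul_assoc, trace_mul_comm Qᵀ, Matrix.mul_assoc, Matrix.mul_assoc,
        hQ', Matrix.mul_one]
    rw [h1]
    rfl
  have hcs : ∀ i, (G *ᵥ Q.col i) ⬝ᵥ (Z *ᵥ Q.col i) ≤
      Real.sqrt ((G *ᵥ Q.col i) ⬝ᵥ (G *ᵥ Q.col i)) * Real.sqrt (e i) := fun i => by
    have := Real.sum_mul_le_sqrt_mul_sqrt Finset.univ (G *ᵥ Q.col i) (Z *ᵥ Q.col i)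
    rw [← hZQ i]
    simpa only [dotProduct, pow_two] using this
  have hle : ∀ i, (G *ᵥ Q.col i) ⬝ᵥ (Z *ᵥ Q.col i) ≤ Real.sqrt (e i) := fun i => by
    have h1 : Real.sqrt ((G *ᵥ Q.col i) ⬝ᵥ (G *ᵥ Q.col i)) ≤ 1 :=
      Real.sqrt_le_one.mpr ((hcontr _).1.trans_eq (hcol i))
    exact (hcs i).trans (mul_le_of_le_one_left (Real.sqrt_nonneg _) h1)
  refine ⟨htr.trans_le (Finset.sum_le_sum fun i _ => hle i), fun heq => ?_⟩
  have heq' : ∀ i, (G *ᵥ Q.col i) ⬝ᵥ (Z *ᵥ Q.col i) = Real.sqrt (e i) := fun i =>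
    (Finset.sum_eq_sum_iff_of_le fun i _ => hle i).mp (htr.symm.trans heq) i (Finset.mem_univ i)
  have hfix : ∀ i, e i ≠ 0 → (V * Vᵀ) *ᵥ Q.col i = Q.col i := fun i hi => by
    by_contra hne
    have h1 : Real.sqrt ((G *ᵥ Q.col i) ⬝ᵥ (G *ᵥ Q.col i)) < 1 := by
      rw [Real.sqrt_lt' one_pos, one_pow, ← hcol i]
      exact (hcontr _).2 hne
    have h2 : 0 < Real.sqrt (e i) := Real.sqrt_pos.mpr (lt_of_le_of_ne (he0 i) hi.symm)
    have h3 := hcs i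
    rw [heq' i] at h3
    nlinarith
  have hdiag : V * Vᵀ * (Q * diagonal e) = Q * diagonal e := by
    ext j i
    rw [← Matrix.mul_assoc, mul_diagonal, mul_diagonal]
    by_cases hi : e i = 0
    · simp [hi]
    · exact congrArg (· * e i) (congrFun (hfix i hi) j)
  have hgram : V * Vᵀ * (Zᵀ * Z) = Zᵀ * Z := by
    have h1 : Zᵀ * Z = Q * diagonal e * Qᵀ := by
      rw [← hd, Matrix.mul_assoc _ Q, hQ', Matrix.mul_one]
    rw [h1, ← Matrix.mul_assoc, hdiag]
  have hPt : (V * Vᵀ)ᵀ = V * Vᵀ := by simp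
  have hzero : (Z * (V * Vᵀ) - Z)ᵀ * (Z * (V * Vᵀ) - Z) = 0 := by
    rw [transpose_sub, transpose_mul, hPt, Matrix.mul_sub, Matrix.sub_mul, Matrix.sub_mul,
      ← Matrix.mul_assoc, Matrix.mul_assoc _ Zᵀ Z, hgram, ← Matrix.mul_assoc Zᵀ Z]
    simp
  rw [← conjTranspose_eq_transpose_of_trivial] at hzero
  exact sub_eq_zero.mp (conjTranspose_mul_self_eq_zero.mp hzero)

/-- The nuclear norm is the trace of the positive semidefinite square root of the Gram matrix. -/
lemma nuclearNorm_eq_trace_of_sq {m n : ℕ} {Z : Matrix (Fin m) (Fin n) ℝ}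
    {P : Matrix (Fin n) (Fin n) ℝ} (hP : P.PosSemidef) (hPZ : P * P = Zᵀ * Z) :
    nuclearNorm Z = trace P := by
  obtain ⟨Q, hQ, hQ', hd⟩ := exists_orthogonal_gram_diagonalization Z
  set e := (Matrix.isHermitian_conjTranspose_mul_self Z).eigenvalues with he
  have hPt : Pᵀ = P := by
    rw [← conjTranspose_eq_transpose_of_trivial]; exact hP.isHermitian.eq
  have hcol : ∀ i, Q.col i ⬝ᵥ Q.col i = 1 := fun i => by
    simpa [mul_apply, dotProduct] using congrFun (congrFun hQ i) i
  have heig : ∀ i, P *ᵥ Q.col i = Real.sqrt (e i) • Q.col i := fun i => by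
    set s := Real.sqrt (e i) with hs
    have hss : s * s = e i := Real.mul_self_sqrt (gram_eigenvalues_nonneg Z i)
    have h1 : P *ᵥ (P *ᵥ Q.col i) = (s * s) • Q.col i := by
      rw [mulVec_mulVec, hPZ, hss]
      ext j
      have := congrFun (congrFun hd j) i
      rw [mul_diagonal] at this
      simpa [mul_apply, mulVec, dotProduct, mul_comm] using this
    set w := P *ᵥ Q.col i - s • Q.col i with hw
    have hPw : P *ᵥ w = (-s) • w := by
      rw [hw, mulVec_sub, h1, mulVec_smul, smul_sub, smul_smul]
      simp only [neg_smul, neg_mul]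
      abel
    have hnn : 0 ≤ w ⬝ᵥ (P *ᵥ w) := by
      simpa using hP.dotProduct_mulVec_nonneg w
    have hww : 0 ≤ w ⬝ᵥ w := by simpa using dotProduct_star_self_nonneg w
    have hw0 : w ⬝ᵥ w = 0 := by
      rcases (Real.sqrt_nonneg (e i)).eq_or_lt with h0 | h0
      · have hs0 : s = 0 := h0.symm
        have hw' : w = P *ᵥ Q.col i := by rw [hw, hs0, zero_smul, sub_zero]
        have h2 := mulVec_dotProduct_mulVec P 1 (Q.col i) w
        rw [one_mulVec, Matrix.mul_one, hPt, hPw, hs0, ← hw'] at h2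
        simpa using h2
      · rw [hPw, dotProduct_smul, smul_eq_mul] at hnn
        change 0 < s at h0
        nlinarith
    exact sub_eq_zero.mp (dotProduct_self_eq_zero.mp hw0)
  have h1 : trace P = trace (Qᵀ * (P * Q)) := by
    rw [trace_mul_comm, Matrix.mul_assoc, hQ', Matrix.mul_one]
  have h2 : trace (Qᵀ * (P * Q)) = ∑ i, Q.col i ⬝ᵥ (P *ᵥ Q.col i) := rfl
  rw [h1, h2]
  simp only [heig, dotProduct_smul, hcol, smul_eq_mul, mul_one]
  rfl

lemma nuclearNorm_eq_trace_of_isReducedSVD {m n r : ℕ} {Z : Matrix (Fin m) (Fin n) ℝ}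
    {U : Matrix (Fin m) (Fin r) ℝ} {S : Matrix (Fin r) (Fin r) ℝ} {V : Matrix (Fin n) (Fin r) ℝ}
    (h : IsReducedSVD Z U S V) : nuclearNorm Z = trace S := by
  obtain ⟨hU, hV, hS, hpos, rfl⟩ := h
  have hSd : S = diagonal fun i => S i i := hS.diagonal_diag.symm
  have hSt : Sᵀ = S := by rw [hSd, diagonal_transpose]
  have hSpos : S.PosSemidef := by
    rw [hSd]; exact PosSemidef.diagonal fun i => (hpos i).le
  have hP : (V * S * Vᵀ).PosSemidef := by
    simpa using hSpos.mul_mul_conjTranspose_same V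
  rw [nuclearNorm_eq_trace_of_sq hP, trace_mul_comm, ← Matrix.mul_assoc, hV, Matrix.one_mul]
  have h1 : V * S * Vᵀ * (V * S * Vᵀ) = V * S * (Vᵀ * V) * S * Vᵀ := by
    simp only [Matrix.mul_assoc]
  have h2 : (U * S * Vᵀ)ᵀ * (U * S * Vᵀ) = V * S * (Uᵀ * U) * S * Vᵀ := by
    simp only [transpose_mul, transpose_transpose, hSt, Matrix.mul_assoc]
  rw [h1, h2, hU, hV]

lemma trace_transpose_mul_eq_sum {m n : ℕ} (D S : Matrix (Fin m) (Fin n) ℝ) :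
    trace (Dᵀ * S) = ∑ i, ∑ j, D i j * S i j := by
  simp only [trace, diag_apply, mul_apply, transpose_apply]
  exact Finset.sum_comm

/-- The trace pairing with a matrix of entries in `[-1, 1]` is at most the `ℓ¹` norm, with equality
only for matrices vanishing wherever those entries lie in `(-1, 1)`. -/
lemma trace_transpose_mul_le_l1Norm {m n : ℕ} {D : Matrix (Fin m) (Fin n) ℝ}
    (hD : ∀ i j, |D i j| ≤ 1) (S : Matrix (Fin m) (Fin n) ℝ) :
    trace (Dᵀ * S) ≤ l1Norm S ∧
      (trace (Dᵀ * S) = l1Norm S → ∀ i j, |D i j| < 1 → S i j = 0) := by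
  have habs : ∀ i j, D i j * S i j ≤ |D i j| * |S i j| := fun i j =>
    (le_abs_self _).trans_eq (abs_mul _ _)
  have hle : ∀ i j, D i j * S i j ≤ |S i j| := fun i j =>
    (habs i j).trans (mul_le_of_le_one_left (abs_nonneg _) (hD i j))
  rw [trace_transpose_mul_eq_sum]
  refine ⟨Finset.sum_le_sum fun i _ => Finset.sum_le_sum fun j _ => hle i j,
    fun heq i j hij => ?_⟩
  have h1 := (Finset.sum_eq_sum_iff_of_le
    fun i _ => Finset.sum_le_sum fun j _ => hle i j).mp heq i (Finset.mem_univ i)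
  have h2 := (Finset.sum_eq_sum_iff_of_le fun j _ => hle i j).mp h1 j (Finset.mem_univ j)
  by_contra hne
  have h3 := abs_pos.mpr hne
  nlinarith [habs i j]

section Frobenius

attribute [local instance] Matrix.frobeniusNormedAddCommGroup Matrix.frobeniusNormedSpace

lemma frobNorm_eq_norm {m n : ℕ} (M : Matrix (Fin m) (Fin n) ℝ) : frobNorm M = ‖M‖ := by
  rw [frobenius_norm_def, frobNorm, Real.sqrt_eq_rpow]
  simp

lemma frobNorm_PΩ_le {m n : ℕ} (Ω : Finset (Fin m × Fin n)) (M : Matrix (Fin m) (Fin n) ℝ) :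
    frobNorm (PΩ Ω M) ≤ frobNorm M := by
  refine Real.sqrt_le_sqrt (Finset.sum_le_sum fun i _ => Finset.sum_le_sum fun j _ => ?_)
  unfold PΩ
  split_ifs
  · exact le_rfl
  · simpa using sq_nonneg (M i j)

lemma bddAbove_frobNorm_PΩ_PT {m n r : ℕ} (Ω : Finset (Fin m × Fin n))
    (U : Matrix (Fin m) (Fin r) ℝ) (V : Matrix (Fin n) (Fin r) ℝ) :
    BddAbove (Set.range fun X : {X : Matrix (Fin m) (Fin n) ℝ // frobNorm X ≤ 1} =>
      frobNorm (PΩ Ω (PT U V X.1))) := by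
  refine ⟨‖U * Uᵀ‖ + ‖V * Vᵀ‖ + ‖U * Uᵀ‖ * ‖V * Vᵀ‖, ?_⟩
  rintro _ ⟨⟨X, hX⟩, rfl⟩
  refine (frobNorm_PΩ_le Ω _).trans ?_
  rw [frobNorm_eq_norm] at hX ⊢
  have h1 : ‖U * Uᵀ * X‖ ≤ ‖U * Uᵀ‖ :=
    (frobenius_norm_mul _ _).trans (mul_le_of_le_one_right (norm_nonneg _) hX)
  have h2 : ‖X * (V * Vᵀ)‖ ≤ ‖V * Vᵀ‖ :=
    (frobenius_norm_mul _ _).trans (mul_le_of_le_one_left (norm_nonneg _) hX)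
  have h3 : ‖U * Uᵀ * X * (V * Vᵀ)‖ ≤ ‖U * Uᵀ‖ * ‖V * Vᵀ‖ :=
    (frobenius_norm_mul _ _).trans (mul_le_mul_of_nonneg_right h1 (norm_nonneg _))
  exact (norm_sub_le _ _).trans (add_le_add ((norm_add_le _ _).trans (add_le_add h1 h2)) h3)

/-- If `P_Ω P_T` has operator norm less than one, its only fixed point is zero. -/
lemma eq_zero_of_PΩ_PT_eq_self {m n r : ℕ} {Ω : Finset (Fin m × Fin n)}
    {U : Matrix (Fin m) (Fin r) ℝ} {V : Matrix (Fin n) (Fin r) ℝ}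
    (h : opNorm (fun M => PΩ Ω (PT U V M)) < 1) {H : Matrix (Fin m) (Fin n) ℝ}
    (hH : PΩ Ω (PT U V H) = H) : H = 0 := by
  by_contra hne
  have hpos : 0 < ‖H‖ := norm_pos_iff.mpr hne
  have hnorm : frobNorm (‖H‖⁻¹ • H) = 1 := by
    rw [frobNorm_eq_norm, norm_smul, norm_inv, norm_norm, inv_mul_cancel₀ hpos.ne']
  have hsmul : PΩ Ω (PT U V (‖H‖⁻¹ • H)) = ‖H‖⁻¹ • H := by
    have h1 : PT U V (‖H‖⁻¹ • H) = ‖H‖⁻¹ • PT U V H := by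
      simp only [PT, Matrix.mul_smul, Matrix.smul_mul, smul_add, smul_sub]
    have h2 : PΩ Ω (‖H‖⁻¹ • PT U V H) = ‖H‖⁻¹ • PΩ Ω (PT U V H) := by
      ext i j
      simp [PΩ]
    rw [h1, h2, hH]
  have := le_ciSup (bddAbove_frobNorm_PΩ_PT Ω U V) ⟨‖H‖⁻¹ • H, hnorm.le⟩
  simp only [hsmul, hnorm] at this
  exact absurd h (not_lt.mpr this)

end Frobenius

lemma abs_apply_le_supNorm {m n : ℕ} (M : Matrix (Fin m) (Fin n) ℝ) (i : Fin m) (j : Fin n) :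
    |M i j| ≤ supNorm M :=
  le_ciSup (f := fun p : Fin m × Fin n => |M p.1 p.2|) (Set.finite_range _).bddAbove (i, j)

lemma transpose_mul_eq_zero_of_PT_eq_zero {m n r : ℕ} {U : Matrix (Fin m) (Fin r) ℝ}
    {V : Matrix (Fin n) (Fin r) ℝ} {W : Matrix (Fin m) (Fin n) ℝ} (hU : Uᵀ * U = 1)
    (hW : PT U V W = 0) : Uᵀ * W = 0 := by
  have h := congrArg (Uᵀ * ·) hW
  have h1 : Uᵀ * (U * Uᵀ * W) = Uᵀ * W := by
    rw [← Matrix.mul_assoc, ← Matrix.mul_assoc, hU, Matrix.one_mul]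
  simpa only [PT, Matrix.mul_add, Matrix.mul_sub, ← Matrix.mul_assoc Uᵀ (U * Uᵀ * W), h1,
    ← Matrix.mul_assoc Uᵀ W, add_sub_cancel_right, Matrix.mul_zero] using h

lemma mul_eq_zero_of_PT_eq_zero {m n r : ℕ} {U : Matrix (Fin m) (Fin r) ℝ}
    {V : Matrix (Fin n) (Fin r) ℝ} {W : Matrix (Fin m) (Fin n) ℝ} (hV : Vᵀ * V = 1)
    (hW : PT U V W = 0) : W * V = 0 := by
  have h := congrArg (· * V) hW
  have h1 : ∀ M : Matrix (Fin m) (Fin n) ℝ, M * (V * Vᵀ) * V = M * V := fun M => by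
    rw [Matrix.mul_assoc, Matrix.mul_assoc, hV, Matrix.mul_one]
  simpa only [PT, Matrix.add_mul, Matrix.sub_mul, h1, add_sub_cancel_left,
    Matrix.zero_mul] using h

theorem dual_certification_rpca {n₁ n₂ r : ℕ} (A : Matrix (Fin n₁) (Fin n₁) ℝ)
    (hA : IsUnit A) (lam : ℝ) (hlam : 0 < lam)
    (X₀ S₀ : Matrix (Fin n₁) (Fin n₂) ℝ) (Ω : Finset (Fin n₁ × Fin n₂))
    (hsupp : ∀ i j, S₀ i j ≠ 0 ↔ (i, j) ∈ Ω)
    (U : Matrix (Fin n₁) (Fin r) ℝ) (Sig : Matrix (Fin r) (Fin r) ℝ)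
    (V : Matrix (Fin n₂) (Fin r) ℝ) (hSVD : IsReducedSVD (A * X₀) U Sig V)
    (hΩT : opNorm (fun M => PΩ Ω (PT U V M)) < 1)
    (W F : Matrix (Fin n₁) (Fin n₂) ℝ)
    (hW : PT U V W = 0) (hWn : specNorm W < 1)
    (hF : PΩ Ω F = 0) (hFn : supNorm F < 1)
    (hdual : Aᵀ * (U * Vᵀ) + Aᵀ * W = lam • (sgn S₀ + F)) :
    UniqueRPCAMin A lam (X₀ + S₀) X₀ S₀ := by
  obtain ⟨hU, hV, -, -, hX₀⟩ := id hSVD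
  have hUW := transpose_mul_eq_zero_of_PT_eq_zero hU hW
  have hWV := mul_eq_zero_of_PT_eq_zero hV hW
  have hnuc := trace_certificate_le_nuclearNorm hU hV hUW hWV hWn
  set D := sgn S₀ + F with hD
  have hFabs : ∀ i j, |F i j| < 1 := fun i j => (abs_apply_le_supNorm F i j).trans_lt hFn
  have hDon : ∀ i j, (i, j) ∈ Ω → D i j = Real.sign (S₀ i j) := fun i j hij => by
    have := congrFun (congrFun hF i) j
    simp only [PΩ, hij, if_true, Matrix.zero_apply] at this
    simp [hD, sgn, this]
  have hDoff : ∀ i j, (i, j) ∉ Ω → D i j = F i j := fun i j hij => by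
    have : S₀ i j = 0 := not_not.mp (mt (hsupp i j).mp hij)
    simp [hD, sgn, this]
  have hDle : ∀ i j, |D i j| ≤ 1 := fun i j => by
    by_cases hij : (i, j) ∈ Ω
    · rw [hDon i j hij]
      rcases Real.sign_apply_eq (S₀ i j) with h | h | h <;> simp [h]
    · rw [hDoff i j hij]; exact (hFabs i j).le
  have hl1 := trace_transpose_mul_le_l1Norm hDle
  have hpair : ∀ X : Matrix (Fin n₁) (Fin n₂) ℝ,
      trace ((U * Vᵀ + W)ᵀ * (A * X)) = lam * trace (Dᵀ * X) := fun X => by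
    rw [← Matrix.mul_assoc, ← transpose_transpose A, ← transpose_mul, Matrix.mul_add,
      hdual, transpose_smul, Matrix.smul_mul, trace_smul, smul_eq_mul]
  have hnuc₀ : nuclearNorm (A * X₀) = trace ((U * Vᵀ + W)ᵀ * (A * X₀)) := by
    have hWU : Wᵀ * U = 0 := by simpa using congrArg transpose hUW
    have h1 : V * Uᵀ * (U * Sig * Vᵀ) = V * (Uᵀ * U) * Sig * Vᵀ := by
      simp only [Matrix.mul_assoc]
    have h2 : Wᵀ * (U * Sig * Vᵀ) = 0 := by
      rw [← Matrix.mul_assoc, ← Matrix.mul_assoc, hWU]; simp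
    rw [nuclearNorm_eq_trace_of_isReducedSVD hSVD, hX₀, transpose_add, transpose_mul,
      transpose_transpose, Matrix.add_mul, h1, h2, hU, add_zero, Matrix.mul_one, trace_mul_comm,
      ← Matrix.mul_assoc, hV, Matrix.one_mul]
  have hl1₀ : l1Norm S₀ = trace (Dᵀ * S₀) := by
    rw [trace_transpose_mul_eq_sum]
    refine Finset.sum_congr rfl fun i _ => Finset.sum_congr rfl fun j _ => ?_
    by_cases hij : (i, j) ∈ Ω
    · rw [hDon i j hij]
      rcases lt_trichotomy (S₀ i j) 0 with h | h | h
      · rw [Real.sign_of_neg h, abs_of_neg h]; ring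
      · simp [h]
      · rw [Real.sign_of_pos h, abs_of_pos h]; ring
    · simp [not_not.mp (mt (hsupp i j).mp hij)]
  refine ⟨rfl, fun X S hXS hne => ?_⟩
  have hval : nuclearNorm (A * X₀) + lam * l1Norm S₀ =
      trace ((U * Vᵀ + W)ᵀ * (A * X)) + lam * trace (Dᵀ * S) := by
    rw [hnuc₀, hl1₀, hpair, hpair, ← mul_add, ← mul_add, ← trace_add, ← trace_add,
      ← Matrix.mul_add, ← Matrix.mul_add, hXS]
  rw [hval]
  have hleX := (hnuc (A * X)).1
  have hleS := mul_le_mul_of_nonneg_left (hl1 S).1 hlam.le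
  refine lt_of_le_of_ne (add_le_add hleX hleS) fun heq => hne ?_
  have hXeq : A * X * (V * Vᵀ) = A * X := (hnuc _).2 (by linarith)
  have hX₀eq : A * X₀ * (V * Vᵀ) = A * X₀ := (hnuc _).2 hnuc₀.symm
  have hSeq := (hl1 S).2 (mul_left_cancel₀ hlam.ne' (by linarith))
  have hrow : (X - X₀) * (V * Vᵀ) = X - X₀ := by
    have h : A * ((X - X₀) * (V * Vᵀ)) = A * (X - X₀) := by
      rw [← Matrix.mul_assoc, Matrix.mul_sub, Matrix.sub_mul, hXeq, hX₀eq]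
    have hinv : A⁻¹ * A = 1 := nonsing_inv_mul A ((isUnit_iff_isUnit_det A).mp hA)
    simpa only [← Matrix.mul_assoc, hinv, Matrix.one_mul] using congrArg (A⁻¹ * ·) h
  have hPT : PT U V (X - X₀) = X - X₀ := by
    rw [PT, Matrix.mul_assoc (U * Uᵀ), hrow, add_sub_cancel_left]
  have hdiff : X - X₀ = S₀ - S := by
    rw [sub_eq_sub_iff_add_eq_add, hXS, add_comm]
  have hPΩ : PΩ Ω (X - X₀) = X - X₀ := by
    ext i j
    by_cases hij : (i, j) ∈ Ω
    · simp [PΩ, hij]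
    · have h1 : S₀ i j = 0 := not_not.mp (mt (hsupp i j).mp hij)
      have h2 : S i j = 0 := hSeq i j (by rw [hDoff i j hij]; exact hFabs i j)
      rw [hdiff]
      simp [PΩ, hij, h1, h2]
  have hzero : X - X₀ = 0 := eq_zero_of_PΩ_PT_eq_self hΩT (by rw [hPT, hPΩ])
  rw [Prod.mk.injEq]
  exact ⟨sub_eq_zero.mp hzero, (sub_eq_zero.mp (hdiff.symm.trans hzero)).symm⟩
end

section
/- (Size property of the matrix-completion dual certificate) There exist numerical constants c > 0 and c₀ > 0 with the following property. Let n = max(n₁, n₂), β ≥ 2, and let U ∈ ℝ^{n₁×r}, V ∈ ℝ^{n₂×r} be the orthonormal singular-vector factors of a rank-r matrix satisfying the incoherence condition with parameter μ. Let Ω ∼ Ber(p) be a random subset of {1,…,n₁}×{1,…,n₂} and m = p n₁ n₂. If m ≥ c₀ max(μ², μ^{4/3} r, μ n^{1/4}) · n r β log(n), then with probability at least 1 − c n^{−β}: the operator P_T P_Ω P_T restricted to T is a bijection of T onto itself, and the matrix Y = P_Ω P_T ((P_T P_Ω P_T)|_T)⁻¹ (U Vᵀ) satisfies ‖P_{T⊥}(Y)‖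 < 1. -/
open Matrix BigOperators

attribute [local instance] Classical.propDecidable

/-! ### Bernoulli expectations over subsets of a finite type -/

section Bernoulli

variable {ι : Type*}

/-- The centered variable `δ i / p - 1`, where `δ i` is the indicator of `i ∈ Ω`. -/
noncomputable def berDev (p : ℝ) (Ω : Finset ι) (i : ι) : ℝ :=
  (if i ∈ Ω then 1 / p else 0) - 1

theorem berDev_insert_self {p : ℝ} (Ω : Finset ι) (i : ι) :
    berDev p (insert i Ω) i = 1 / p - 1 := by simp [berDev]

theorem berDev_erase_self {p : ℝ} (Ω : Finset ι) (i : ι) :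
    berDev p (Ω.erase i) i = -1 := by simp [berDev]

theorem neg_one_le_berDev {p : ℝ} (hp : 0 ≤ p) (Ω : Finset ι) (i : ι) : -1 ≤ berDev p Ω i := by
  unfold berDev
  split_ifs
  · have : 0 ≤ 1 / p := by positivity
    linarith
  · linarith

variable [Fintype ι]

/-- The probability of the subset `Ω` when every index is kept independently with probability `p`. -/
noncomputable def berWeight (p : ℝ) (Ω : Finset ι) : ℝ :=
  p ^ Ω.card * (1 - p) ^ (Fintype.card ι - Ω.card)

/-- The expectation of `f Ω` for `Ω ∼ Ber(p)`. -/
noncomputable def berExp (p : ℝ) (f : Finset ι → ℝ) : ℝ :=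
  ∑ Ω : Finset ι, berWeight p Ω * f Ω

/-- The probability of the event `P` for `Ω ∼ Ber(p)`. -/
noncomputable def berPr (p : ℝ) (P : Finset ι → Prop) : ℝ :=
  berExp p (fun Ω => if P Ω then 1 else 0)

theorem berWeight_nonneg {p : ℝ} (h0 : 0 ≤ p) (h1 : p ≤ 1) (Ω : Finset ι) :
    0 ≤ berWeight p Ω :=
  mul_nonneg (pow_nonneg h0 _) (pow_nonneg (sub_nonneg.2 h1) _)

theorem berWeight_eq_prod (p : ℝ) (Ω : Finset ι) :
    berWeight p Ω = (∏ _i ∈ Ω, p) * ∏ _i ∈ Ωᶜ, (1 - p) := by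
  simp [berWeight, Finset.card_compl]

theorem berExp_const (p c : ℝ) : berExp (ι := ι) p (fun _ => c) = c := by
  have h := Fintype.sum_pow_mul_eq_add_pow ι p (1 - p)
  rw [add_sub_cancel, one_pow] at h
  simp only [berExp, berWeight]
  rw [← Finset.sum_mul, h, one_mul]

theorem berExp_add (p : ℝ) (f g : Finset ι → ℝ) :
    berExp p (fun Ω => f Ω + g Ω) = berExp p f + berExp p g := by
  simp [berExp, mul_add, Finset.sum_add_distrib]

theorem berExp_const_mul (p c : ℝ) (f : Finset ι → ℝ) :
    berExp p (fun Ω => c * f Ω) = c * berExp p f := by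
  simp only [berExp, Finset.mul_sum]
  exact Finset.sum_congr rfl fun _ _ => by ring

theorem berExp_sum {κ : Type*} (p : ℝ) (s : Finset κ) (f : κ → Finset ι → ℝ) :
    berExp p (fun Ω => ∑ k ∈ s, f k Ω) = ∑ k ∈ s, berExp p (f k) := by
  simp only [berExp, Finset.mul_sum]
  exact Finset.sum_comm

theorem berExp_mono {p : ℝ} (h0 : 0 ≤ p) (h1 : p ≤ 1) {f g : Finset ι → ℝ}
    (h : ∀ Ω, f Ω ≤ g Ω) : berExp p f ≤ berExp p g :=
  Finset.sum_le_sum fun Ω _ => mul_le_mul_of_nonneg_left (h Ω) (berWeight_nonneg h0 h1 Ω)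

theorem berExp_prod (p : ℝ) (g h : ι → ℝ) :
    berExp p (fun Ω => ∏ i, if i ∈ Ω then g i else h i) = ∏ i, (p * g i + (1 - p) * h i) := by
  rw [Fintype.prod_add]
  refine Finset.sum_congr rfl fun Ω _ => ?_
  beta_reduce
  rw [berWeight_eq_prod, ← Finset.prod_mul_prod_compl Ω, Finset.prod_mul_distrib,
    Finset.prod_mul_distrib]
  have e1 : ∏ i ∈ Ω, (if i ∈ Ω then g i else h i) = ∏ i ∈ Ω, g i :=
    Finset.prod_congr rfl fun i hi => if_pos hi
  have e2 : ∏ i ∈ Ωᶜ, (if i ∈ Ω then g i else h i) = ∏ i ∈ Ωᶜ, h i :=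
    Finset.prod_congr rfl fun i hi => if_neg (Finset.mem_compl.1 hi)
  rw [e1, e2]
  ring

/-- Averaging over the single coordinate `i`. -/
theorem berExp_eq_coordinate (p : ℝ) (i : ι) (f : Finset ι → ℝ) :
    berExp p f = berExp p (fun Ω => p * f (insert i Ω) + (1 - p) * f (Ω.erase i)) := by
  have split : ∀ G : Finset ι → ℝ, ∑ Ω, G Ω =
      ∑ t ∈ (Finset.univ.erase i).powerset, (G t + G (insert i t)) := by
    intro G
    rw [Finset.sum_add_distrib, ← Finset.sum_powerset_insert (Finset.notMem_erase i _),
      Finset.insert_erase (Finset.mem_univ i), Finset.powerset_univ]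
  unfold berExp
  rw [split, split]
  refine Finset.sum_congr rfl fun t ht => ?_
  have hit : i ∉ t := fun h => Finset.notMem_erase i _ (Finset.mem_powerset.1 ht h)
  have hlt : t.card < Fintype.card ι := by
    rw [← Finset.card_univ]
    exact Finset.card_lt_card ((Finset.ssubset_univ_iff).2 fun h => hit (h ▸ Finset.mem_univ i))
  obtain ⟨k, hk⟩ := Nat.exists_eq_add_of_lt hlt
  have w1 : berWeight p t = (1 - p) * (p ^ t.card * (1 - p) ^ k) := by
    rw [berWeight, show Fintype.card ι - t.card = k + 1 by omega]
    ring
  have w2 : berWeight p (insert i t) = p * (p ^ t.card * (1 - p) ^ k) := by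
    rw [berWeight, Finset.card_insert_of_notMem hit,
      show Fintype.card ι - (t.card + 1) = k by omega]
    ring
  beta_reduce
  rw [w1, w2, Finset.erase_eq_of_notMem hit, Finset.insert_idem, Finset.erase_insert hit]
  ring

theorem berPr_le_berExp {p : ℝ} (h0 : 0 ≤ p) (h1 : p ≤ 1) {P : Finset ι → Prop}
    {f : Finset ι → ℝ} (hf : ∀ Ω, 0 ≤ f Ω) (hP : ∀ Ω, P Ω → 1 ≤ f Ω) :
    berPr p P ≤ berExp p f :=
  berExp_mono h0 h1 fun Ω => by
    split_ifs with h
    · exact hP Ω h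
    · exact hf Ω

theorem berPr_mono {p : ℝ} (h0 : 0 ≤ p) (h1 : p ≤ 1) {P Q : Finset ι → Prop}
    (h : ∀ Ω, P Ω → Q Ω) : berPr p P ≤ berPr p Q :=
  berPr_le_berExp h0 h1 (fun Ω => by split_ifs <;> norm_num) fun Ω hΩ => by simp [h Ω hΩ]

theorem berPr_or_le {p : ℝ} (h0 : 0 ≤ p) (h1 : p ≤ 1) (P Q : Finset ι → Prop) :
    berPr p (fun Ω => P Ω ∨ Q Ω) ≤ berPr p P + berPr p Q := by
  unfold berPr
  rw [← berExp_add]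
  refine berExp_mono h0 h1 fun Ω => ?_
  by_cases hP : P Ω <;> by_cases hQ : Q Ω <;> simp [hP, hQ]

theorem berPr_exists_le {κ : Type*} [Fintype κ] {p : ℝ} (h0 : 0 ≤ p) (h1 : p ≤ 1)
    (P : κ → Finset ι → Prop) {b : ℝ} (hb : ∀ k, berPr p (P k) ≤ b) :
    berPr p (fun Ω => ∃ k, P k Ω) ≤ Fintype.card κ * b := by
  calc berPr p (fun Ω => ∃ k, P k Ω)
      ≤ berExp p (fun Ω => ∑ k, if P k Ω then (1 : ℝ) else 0) := by
        have hnn : ∀ Ω k, (0 : ℝ) ≤ if P k Ω then (1 : ℝ) else 0 := fun Ω k => by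
          split_ifs <;> norm_num
        refine berPr_le_berExp h0 h1 (fun Ω => Finset.sum_nonneg fun k _ => hnn Ω k) ?_
        rintro Ω ⟨k, hk⟩
        refine le_trans ?_ (Finset.single_le_sum (fun k _ => hnn Ω k) (Finset.mem_univ k))
        rw [if_pos hk]
    _ = ∑ k, berPr p (P k) := berExp_sum _ _ _
    _ ≤ ∑ _k : κ, b := Finset.sum_le_sum fun k _ => hb k
    _ = _ := by simp

theorem berPr_compl (p : ℝ) (P : Finset ι → Prop) :
    berPr p P = 1 - berPr p (fun Ω => ¬ P Ω) := by
  rw [eq_sub_iff_add_eq]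
  unfold berPr
  rw [← berExp_add]
  refine Eq.trans ?_ (berExp_const (ι := ι) p 1)
  congr 1
  ext Ω
  by_cases hP : P Ω <;> simp [hP]

/-- Bernstein's inequality for weighted sums of centered Bernoulli variables, upper tail. -/
theorem berExp_sum_berDev_gt_le {p : ℝ} (h0 : 0 < p) (h1 : p ≤ 1) (c : ι → ℝ) {v R s : ℝ}
    (hv : ∑ i, c i ^ 2 ≤ v) (hR : ∀ i, |c i| ≤ R) (hv0 : 0 < v) (hs : 0 < s)
    (hsR : s * R ^ 2 ≤ p * v) :
    berPr p (fun Ω => 2 * √(s * v / p) < ∑ i, berDev p Ω i * c i) ≤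
      Real.exp (-s) := by
  set l : ℝ := √(s * p / v) with hl
  have hlpos : 0 < l := Real.sqrt_pos.2 (by positivity)
  have hl2 : l ^ 2 = s * p / v := Real.sq_sqrt (by positivity)
  have hlt : l * √(s * v / p) = s := by
    rw [hl, ← Real.sqrt_mul (by positivity)]
    rw [show s * p / v * (s * v / p) = s ^ 2 by field_simp]
    exact Real.sqrt_sq hs.le
  have hlc : ∀ i, |l * c i / p| ≤ 1 := by
    intro i
    rw [← sq_le_one_iff_abs_le_one, div_pow, mul_pow, hl2, div_le_one (by positivity)]
    have hc : c i ^ 2 ≤ R ^ 2 := sq_le_sq' (by linarith [neg_abs_le (c i), hR i])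
      ((le_abs_self _).trans (hR i))
    rw [div_mul_eq_mul_div, div_le_iff₀ hv0]
    calc s * p * c i ^ 2 ≤ s * p * R ^ 2 := by gcongr
      _ = p * (s * R ^ 2) := by ring
      _ ≤ p * (p * v) := by gcongr
      _ = p ^ 2 * v := by ring
  have markov := berPr_le_berExp h0.le h1
    (P := fun Ω => 2 * √(s * v / p) < ∑ i, berDev p Ω i * c i)
    (f := fun Ω => Real.exp (-(2 * s)) * ∏ i, Real.exp (l * (berDev p Ω i * c i)))
    (fun Ω => by positivity)
    (fun Ω h => by
      rw [← Real.exp_sum, ← Real.exp_add, ← Finset.mul_sum]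
      refine Real.one_le_exp ?_
      have := mul_le_mul_of_nonneg_left h.le hlpos.le
      linarith [this, hlt])
  refine markov.trans ?_
  rw [berExp_const_mul]
  have hprod := berExp_prod (ι := ι) p (fun i => Real.exp (l * ((1 / p - 1) * c i)))
    (fun i => Real.exp (l * ((0 - 1) * c i)))
  have hle : berExp p (fun Ω => ∏ i, Real.exp (l * (berDev p Ω i * c i))) ≤ Real.exp s := by
    have e : berExp p (fun Ω => ∏ i, Real.exp (l * (berDev p Ω i * c i))) =
        ∏ i, (p * Real.exp (l * ((1 / p - 1) * c i)) +
          (1 - p) * Real.exp (l * ((0 - 1) * c i))) := by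
      rw [← hprod]
      congr 1
      ext Ω
      refine Finset.prod_congr rfl fun i _ => ?_
      unfold berDev
      split_ifs <;> rfl
    rw [e]
    calc _ ≤ ∏ i, Real.exp (l ^ 2 * c i ^ 2 / p) := by
          refine Finset.prod_le_prod (fun i _ => ?_) fun i _ => ?_
          · have := sub_nonneg.2 h1
            positivity
          · have hx := hlc i
            set x := l * c i / p with hxdef
            have e1 : l * ((1 / p - 1) * c i) = x - p * x := by
              rw [hxdef]; field_simp
            have e2 : l * ((0 - 1) * c i) = -(p * x) := by
              rw [hxdef]; field_simp; ring
            have e3 : l ^ 2 * c i ^ 2 / p = p * x ^ 2 := by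
              rw [hxdef]; field_simp
            rw [e1, e2, e3, sub_eq_add_neg, Real.exp_add]
            have hexp := (abs_le.1 (Real.abs_exp_sub_one_sub_id_le hx)).2
            calc p * (Real.exp x * Real.exp (-(p * x))) + (1 - p) * Real.exp (-(p * x))
                = (1 + p * (Real.exp x - 1)) * Real.exp (-(p * x)) := by ring
              _ ≤ Real.exp (p * (x + x ^ 2)) * Real.exp (-(p * x)) := by
                  gcongr
                  have := Real.add_one_le_exp (p * (x + x ^ 2))
                  nlinarith
              _ = Real.exp (p * x ^ 2) := by rw [← Real.exp_add]; congr 1; ring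
      _ = Real.exp (∑ i, l ^ 2 * c i ^ 2 / p) := (Real.exp_sum _ _).symm
      _ ≤ Real.exp s := by
          refine Real.exp_le_exp.2 ?_
          rw [← Finset.sum_div, ← Finset.mul_sum, hl2, div_le_iff₀ h0, div_mul_eq_mul_div,
            div_le_iff₀ hv0]
          have : 0 ≤ s * p := by positivity
          nlinarith
  calc Real.exp (-(2 * s)) * _ ≤ Real.exp (-(2 * s)) * Real.exp s := by gcongr
    _ = Real.exp (-s) := by rw [← Real.exp_add]; congr 1; ring

/-- Bernstein's inequality for weighted sums of centered Bernoulli variables. -/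
theorem berExp_abs_sum_berDev_gt_le {p : ℝ} (h0 : 0 < p) (h1 : p ≤ 1) (c : ι → ℝ) {v R s : ℝ}
    (hv : ∑ i, c i ^ 2 ≤ v) (hR : ∀ i, |c i| ≤ R) (hv0 : 0 < v) (hs : 0 < s)
    (hsR : s * R ^ 2 ≤ p * v) :
    berPr p (fun Ω => 2 * √(s * v / p) < |∑ i, berDev p Ω i * c i|) ≤
      2 * Real.exp (-s) := by
  have hp := berExp_sum_berDev_gt_le h0 h1 c hv hR hv0 hs hsR
  have hm := berExp_sum_berDev_gt_le h0 h1 (fun i => -c i) (by simpa using hv)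
    (by simpa using hR) hv0 hs hsR
  have hor := (berPr_mono h0.le h1 fun Ω (h : 2 * √(s * v / p) < |∑ i, berDev p Ω i * c i|) =>
    (lt_abs.1 h).imp_right fun h => (show 2 * √(s * v / p) < ∑ i, berDev p Ω i * -c i by
      simpa using h)).trans (berPr_or_le h0.le h1 _ _)
  linarith

end Bernoulli

/-! ### Moments of sums of random rank-one matrices -/

theorem pow_mul_pow_add_pow_mul_pow_le (x y : ℝ) {i j : ℕ} (h : Even (i + j)) :
    x ^ i * y ^ j + x ^ j * y ^ i ≤ x ^ (i + j) + y ^ (i + j) := by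
  have key : |x| ^ i * |y| ^ j + |x| ^ j * |y| ^ i ≤ |x| ^ (i + j) + |y| ^ (i + j) := by
    have : 0 ≤ (|x| ^ i - |y| ^ i) * (|x| ^ j - |y| ^ j) := by
      rcases le_total |x| |y| with hxy | hxy
      · exact mul_nonneg_of_nonpos_of_nonpos
          (sub_nonpos.2 (pow_le_pow_left₀ (abs_nonneg _) hxy _))
          (sub_nonpos.2 (pow_le_pow_left₀ (abs_nonneg _) hxy _))
      · exact mul_nonneg (sub_nonneg.2 (pow_le_pow_left₀ (abs_nonneg _) hxy _))
          (sub_nonneg.2 (pow_le_pow_left₀ (abs_nonneg _) hxy _))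
    rw [pow_add, pow_add]
    linarith
  rw [h.pow_abs, h.pow_abs] at key
  refine le_trans (add_le_add ?_ ?_) key
  · rw [← abs_pow, ← abs_pow, ← abs_mul]
    exact le_abs_self _
  · rw [← abs_pow, ← abs_pow, ← abs_mul]
    exact le_abs_self _

theorem sub_mul_pow_sub_pow_le (x y : ℝ) (k : ℕ) :
    (x - y) * (x ^ (2 * k + 1) - y ^ (2 * k + 1)) ≤
      ((2 * k + 1 : ℝ) / 2) * ((x - y) ^ 2 * (x ^ (2 * k) + y ^ (2 * k))) := by
  have hg := (Commute.all x y).geom_sum₂_mul (2 * k + 1)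
  have hrefl : ∑ i ∈ Finset.range (2 * k + 1), x ^ i * y ^ (2 * k + 1 - 1 - i) =
      ∑ i ∈ Finset.range (2 * k + 1), x ^ (2 * k + 1 - 1 - i) * y ^ i := by
    rw [← Finset.sum_range_reflect]
    refine Finset.sum_congr rfl fun i hi => ?_
    have := Finset.mem_range.1 hi
    rw [show 2 * k + 1 - 1 - (2 * k + 1 - 1 - i) = i by omega]
  have hle : 2 * ∑ i ∈ Finset.range (2 * k + 1), x ^ i * y ^ (2 * k + 1 - 1 - i) ≤
      (2 * k + 1) * (x ^ (2 * k) + y ^ (2 * k)) := by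
    rw [two_mul]
    nth_rewrite 2 [hrefl]
    rw [← Finset.sum_add_distrib]
    refine (Finset.sum_le_card_nsmul _ _ (x ^ (2 * k) + y ^ (2 * k)) fun i hi => ?_).trans ?_
    · have := Finset.mem_range.1 hi
      have h := pow_mul_pow_add_pow_mul_pow_le x y (i := i) (j := 2 * k + 1 - 1 - i)
        ⟨k, by omega⟩
      rwa [show i + (2 * k + 1 - 1 - i) = 2 * k by omega] at h
    · simp [mul_add]
  rw [← hg]
  nlinarith [sq_nonneg (x - y), mul_le_mul_of_nonneg_left hle (sq_nonneg (x - y))]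

section Trace

variable {d : Type*} [Fintype d] [DecidableEq d]

theorem Matrix.IsHermitian.exists_pow_eq {X : Matrix d d ℝ} (hX : X.IsHermitian) (k : ℕ) :
    X ^ k = (hX.eigenvectorUnitary : Matrix d d ℝ) * diagonal (fun a => hX.eigenvalues a ^ k) *
      (hX.eigenvectorUnitary : Matrix d d ℝ)ᵀ := by
  have h := congrArg (· ^ k) hX.spectral_theorem
  simp only [← map_pow, diagonal_pow] at h
  rw [h, Unitary.conjStarAlgAut_apply]
  rfl

/-- The traces of all products of powers of two symmetric matrices are integrals of monomials
against one nonnegative weight on pairs of eigenvalues. -/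
theorem exists_trace_pow_mul_pow {X Y : Matrix d d ℝ} (hX : X.IsHermitian) (hY : Y.IsHermitian) :
    ∃ (x y : d → ℝ) (w : d → d → ℝ), (∀ a b, 0 ≤ w a b) ∧
      ∀ k l : ℕ, trace (X ^ k * Y ^ l) = ∑ a, ∑ b, w a b * (x a ^ k * y b ^ l) := by
  set P := (hX.eigenvectorUnitary : Matrix d d ℝ)
  set Q := (hY.eigenvectorUnitary : Matrix d d ℝ)
  refine ⟨hX.eigenvalues, hY.eigenvalues, fun a b => (Pᵀ * Q) a b ^ 2,
    fun a b => sq_nonneg _, fun k l => ?_⟩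
  rw [hX.exists_pow_eq, hY.exists_pow_eq]
  have e : trace (P * diagonal (fun a => hX.eigenvalues a ^ k) * Pᵀ *
      (Q * diagonal (fun a => hY.eigenvalues a ^ l) * Qᵀ)) =
      trace (diagonal (fun a => hX.eigenvalues a ^ k) * ((Pᵀ * Q) *
        diagonal (fun a => hY.eigenvalues a ^ l) * (Pᵀ * Q)ᵀ)) := by
    rw [Matrix.mul_assoc P, Matrix.mul_assoc P, trace_mul_comm P]
    simp only [transpose_mul, transpose_transpose, Matrix.mul_assoc]
  rw [e, trace]
  refine Finset.sum_congr rfl fun a _ => ?_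
  rw [diag_apply, diagonal_mul, mul_apply, Finset.mul_sum]
  refine Finset.sum_congr rfl fun b _ => ?_
  rw [mul_diagonal, transpose_apply]
  ring

/-- A Klein-type trace inequality for odd powers. -/
theorem trace_sub_mul_pow_sub_pow_le {X Y : Matrix d d ℝ} (hX : X.IsHermitian)
    (hY : Y.IsHermitian) (k : ℕ) :
    trace ((X - Y) * (X ^ (2 * k + 1) - Y ^ (2 * k + 1))) ≤
      ((2 * k + 1 : ℝ) / 2) * trace ((X - Y) * (X - Y) * (X ^ (2 * k) + Y ^ (2 * k))) := by
  obtain ⟨x, y, w, hw, h⟩ := exists_trace_pow_mul_pow hX hY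
  have e1 : trace ((X - Y) * (X ^ (2 * k + 1) - Y ^ (2 * k + 1))) =
      trace (X ^ (2 * k + 2) * Y ^ 0) - trace (X ^ 1 * Y ^ (2 * k + 1)) -
        trace (X ^ (2 * k + 1) * Y ^ 1) + trace (X ^ 0 * Y ^ (2 * k + 2)) := by
    rw [sub_mul, mul_sub, mul_sub, trace_sub, trace_sub, trace_sub, trace_mul_comm Y (X ^ _)]
    rw [← pow_succ', ← pow_succ']
    simp only [pow_one, pow_zero, mul_one, one_mul]
    ring
  have e2 : trace ((X - Y) * (X - Y) * (X ^ (2 * k) + Y ^ (2 * k))) =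
      trace (X ^ (2 * k + 2) * Y ^ 0) - 2 * trace (X ^ (2 * k + 1) * Y ^ 1) +
        trace (X ^ (2 * k) * Y ^ 2) + trace (X ^ 2 * Y ^ (2 * k)) -
        2 * trace (X ^ 1 * Y ^ (2 * k + 1)) + trace (X ^ 0 * Y ^ (2 * k + 2)) := by
    have f1 : trace (X * Y * X ^ (2 * k)) = trace (X ^ (2 * k + 1) * Y ^ 1) := by
      rw [trace_mul_comm, ← Matrix.mul_assoc, ← pow_succ, pow_one]
    have f2 : trace (Y * X * X ^ (2 * k)) = trace (X ^ (2 * k + 1) * Y ^ 1) := by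
      rw [Matrix.mul_assoc, ← pow_succ', trace_mul_comm, pow_one]
    have f3 : trace (Y * Y * X ^ (2 * k)) = trace (X ^ (2 * k) * Y ^ 2) := by
      rw [trace_mul_comm, pow_two Y]
    have f4 : trace (X * Y * Y ^ (2 * k)) = trace (X ^ 1 * Y ^ (2 * k + 1)) := by
      rw [Matrix.mul_assoc, ← pow_succ', pow_one]
    have f5 : trace (Y * X * Y ^ (2 * k)) = trace (X ^ 1 * Y ^ (2 * k + 1)) := by
      rw [Matrix.mul_assoc, trace_mul_comm, Matrix.mul_assoc, ← pow_succ, pow_one]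
    have f6 : trace (X * X * X ^ (2 * k)) = trace (X ^ (2 * k + 2) * Y ^ 0) := by
      rw [← pow_two, ← pow_add, add_comm 2, pow_zero, mul_one]
    have f7 : trace (Y * Y * Y ^ (2 * k)) = trace (X ^ 0 * Y ^ (2 * k + 2)) := by
      rw [← pow_two, ← pow_add, add_comm 2, pow_zero, one_mul]
    rw [mul_add, sub_mul, mul_sub, mul_sub]
    simp only [sub_mul, trace_add, trace_sub, f1, f2, f3, f4, f5, f6, f7]
    rw [pow_two X]
    ring
  rw [e1, e2]
  simp only [h]
  simp only [Finset.mul_sum, ← Finset.sum_sub_distrib, ← Finset.sum_add_distrib]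
  refine Finset.sum_le_sum fun a _ => Finset.sum_le_sum fun b _ => ?_
  have := mul_le_mul_of_nonneg_left (sub_mul_pow_sub_pow_le (x a) (y b) k) (hw a b)
  ring_nf at this ⊢
  linarith

theorem trace_mul_pow_odd_le {X : Matrix d d ℝ} (hX : X.IsHermitian) (K : ℝ) (k : ℕ) :
    K * trace (X ^ (2 * k + 1)) ≤
      trace (X ^ (2 * k + 2)) / 2 + K ^ 2 / 2 * trace (X ^ (2 * k)) := by
  obtain ⟨x, y, w, hw, h⟩ := exists_trace_pow_mul_pow hX hX
  have h' : ∀ k, trace (X ^ k) = ∑ a, ∑ b, w a b * x a ^ k := fun k => by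
    have := h k 0
    simpa using this
  simp only [h', Finset.mul_sum, Finset.sum_div, ← Finset.sum_add_distrib]
  refine Finset.sum_le_sum fun a _ => Finset.sum_le_sum fun b _ => ?_
  have : 0 ≤ w a b * (x a ^ k * (x a - K)) ^ 2 := mul_nonneg (hw a b) (sq_nonneg _)
  ring_nf at this ⊢
  linarith

theorem trace_pow_even_nonneg {X : Matrix d d ℝ} (hX : X.IsHermitian) (k : ℕ) :
    0 ≤ trace (X ^ (2 * k)) := by
  obtain ⟨x, y, w, hw, h⟩ := exists_trace_pow_mul_pow hX hX
  have := h (2 * k) 0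
  rw [pow_zero, mul_one] at this
  rw [this]
  refine Finset.sum_nonneg fun a _ => Finset.sum_nonneg fun b _ => mul_nonneg (hw a b) ?_
  rw [pow_mul, pow_zero, mul_one]
  positivity

theorem trace_vecMulVec_mul (a : d → ℝ) (M : Matrix d d ℝ) :
    trace (vecMulVec a a * M) = a ⬝ᵥ M *ᵥ a := by
  rw [vecMulVec_mul, trace_vecMulVec, dotProduct_comm, ← dotProduct_mulVec]

theorem dotProduct_pow_even_mulVec {X : Matrix d d ℝ} (hX : X.IsHermitian) (a : d → ℝ) (k : ℕ) :
    a ⬝ᵥ (X ^ (2 * k)) *ᵥ a = ((X ^ k) *ᵥ a) ⬝ᵥ ((X ^ k) *ᵥ a) := by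
  have hT : (X ^ k)ᵀ = X ^ k := hX.pow k
  rw [two_mul, pow_add, ← mulVec_mulVec, dotProduct_mulVec]
  nth_rewrite 1 [← hT]
  rw [vecMul_transpose]

theorem abs_dotProduct_mulVec_le_of_trace_pow_le {X : Matrix d d ℝ} (hX : X.IsHermitian)
    {q : ℕ} (hq : q ≠ 0) {t : ℝ} (ht : 0 ≤ t) (h : trace (X ^ (2 * q)) ≤ t ^ (2 * q))
    (x y : d → ℝ) : |x ⬝ᵥ X *ᵥ y| ≤ t * √(x ⬝ᵥ x) * √(y ⬝ᵥ y) := by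
  set P := (hX.eigenvectorUnitary : Matrix d d ℝ) with hP
  have hPP : P * Pᵀ = 1 := Unitary.mul_star_self_of_mem hX.eigenvectorUnitary.2
  have hPP' : Pᵀ * P = 1 := Unitary.star_mul_self_of_mem hX.eigenvectorUnitary.2
  have hev : ∀ a, |hX.eigenvalues a| ≤ t := by
    have htr : trace (X ^ (2 * q)) = ∑ a, hX.eigenvalues a ^ (2 * q) := by
      rw [hX.exists_pow_eq, trace_mul_comm, ← Matrix.mul_assoc, ← hP, hPP', one_mul,
        trace_diagonal]
    intro a
    rw [htr] at h
    have := (Finset.single_le_sum (f := fun a => hX.eigenvalues a ^ (2 * q))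
      (fun a _ => by rw [pow_mul]; positivity) (Finset.mem_univ a)).trans h
    rw [← (even_two_mul q).pow_abs] at this
    exact le_of_pow_le_pow_left₀ (by omega) ht this
  have hdot : ∀ z : d → ℝ, (Pᵀ *ᵥ z) ⬝ᵥ (Pᵀ *ᵥ z) = z ⬝ᵥ z := fun z => by
    rw [dotProduct_mulVec, vecMul_transpose, mulVec_mulVec, hPP, one_mulVec]
  have hXd : X = P * diagonal hX.eigenvalues * Pᵀ := by
    have := hX.exists_pow_eq 1
    simpa using this
  have e : x ⬝ᵥ X *ᵥ y = ∑ a, hX.eigenvalues a * ((Pᵀ *ᵥ x) a * (Pᵀ *ᵥ y) a) := by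
    conv_lhs => rw [hXd]
    rw [← mulVec_mulVec, ← mulVec_mulVec, dotProduct_mulVec, ← mulVec_transpose]
    refine Finset.sum_congr rfl fun a _ => ?_
    rw [mulVec_diagonal]
    ring
  rw [e]
  calc |∑ a, hX.eigenvalues a * ((Pᵀ *ᵥ x) a * (Pᵀ *ᵥ y) a)|
      ≤ ∑ a, |hX.eigenvalues a * ((Pᵀ *ᵥ x) a * (Pᵀ *ᵥ y) a)| := Finset.abs_sum_le_sum_abs _ _
    _ ≤ ∑ a, t * (|(Pᵀ *ᵥ x) a| * |(Pᵀ *ᵥ y) a|) := by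
        refine Finset.sum_le_sum fun a _ => ?_
        rw [abs_mul, abs_mul]
        exact mul_le_mul_of_nonneg_right (hev a) (by positivity)
    _ = t * ∑ a, |(Pᵀ *ᵥ x) a| * |(Pᵀ *ᵥ y) a| := by rw [Finset.mul_sum]
    _ ≤ t * (√(∑ a, |(Pᵀ *ᵥ x) a| ^ 2) * √(∑ a, |(Pᵀ *ᵥ y) a| ^ 2)) := by
        gcongr
        exact Real.sum_mul_le_sqrt_mul_sqrt _ _ _
    _ = t * √(x ⬝ᵥ x) * √(y ⬝ᵥ y) := by
        rw [← hdot x, ← hdot y, mul_assoc]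
        simp only [dotProduct, pow_two, abs_mul_abs_self]

end Trace

section Moments

variable {ι d : Type*} [Fintype ι] [Fintype d] [DecidableEq d]

/-- The random matrix `∑ i, (δ i / p - 1) a i (a i)ᵀ`. -/
noncomputable def berSum (p : ℝ) (a : ι → d → ℝ) (Ω : Finset ι) : Matrix d d ℝ :=
  ∑ i, berDev p Ω i • vecMulVec (a i) (a i)

theorem berSum_isHermitian (p : ℝ) (a : ι → d → ℝ) (Ω : Finset ι) :
    (berSum p a Ω).IsHermitian := by
  unfold IsHermitian berSum
  rw [conjTranspose_sum]
  refine Finset.sum_congr rfl fun i _ => ?_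
  rw [conjTranspose_smul, conjTranspose_eq_transpose_of_trivial, transpose_vecMulVec]
  simp

theorem dotProduct_berSum_mulVec (p : ℝ) (a : ι → d → ℝ) (Ω : Finset ι) (x y : d → ℝ) :
    x ⬝ᵥ berSum p a Ω *ᵥ y = ∑ i, berDev p Ω i * ((a i ⬝ᵥ x) * (a i ⬝ᵥ y)) := by
  rw [berSum, sum_mulVec, dotProduct_sum]
  refine Finset.sum_congr rfl fun i _ => ?_
  rw [smul_mulVec, vecMulVec_mulVec, dotProduct_smul]
  simp [dotProduct_comm x, mul_comm]

theorem berSum_insert_sub_erase (p : ℝ) (a : ι → d → ℝ) (Ω : Finset ι) (i : ι) :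
    berSum p a (insert i Ω) - berSum p a (Ω.erase i) = (1 / p) • vecMulVec (a i) (a i) := by
  unfold berSum
  rw [← Finset.sum_sub_distrib, Finset.sum_eq_single i]
  · rw [berDev_insert_self, berDev_erase_self, ← sub_smul]
    ring_nf
  · intro j _ hj
    have : berDev p (insert i Ω) j = berDev p (Ω.erase i) j := by
      simp [berDev, hj]
    rw [this, sub_self]
  · simp

/-- The moment recursion behind the noncommutative Khintchine-type bound. -/
theorem berExp_trace_pow_succ_le {p R B K : ℝ} (h0 : 0 < p) (h1 : p ≤ 1) (a : ι → d → ℝ)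
    (hR : ∀ i, a i ⬝ᵥ a i ≤ R) (hB : ∀ x : d → ℝ, ∑ i, (a i ⬝ᵥ x) ^ 2 ≤ B * (x ⬝ᵥ x))
    (hR0 : 0 ≤ R) (hB0 : 0 ≤ B) (k : ℕ) (hK : (k + 1 : ℝ) * R / p ≤ K) :
    berExp p (fun Ω => trace (berSum p a Ω ^ (2 * (k + 1)))) ≤
      (4 * K * B + K ^ 2) * berExp p (fun Ω => trace (berSum p a Ω ^ (2 * k))) := by
  set S := berSum p a with hS
  have hSh : ∀ Ω, (S Ω).IsHermitian := berSum_isHermitian p a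
  set κ : ℝ := (2 * k + 1) / 2 * (R / p) with hκ
  have hκ0 : 0 ≤ κ := by positivity
  have hκK : κ ≤ K := by
    refine le_trans ?_ hK
    rw [hκ, mul_div_assoc]
    have : 0 ≤ R / p := by positivity
    nlinarith
  have hnn : ∀ i Ω, 0 ≤ a i ⬝ᵥ (S Ω ^ (2 * k)) *ᵥ a i := fun i Ω => by
    rw [dotProduct_pow_even_mulVec (hSh Ω)]
    exact Finset.sum_nonneg fun _ _ => mul_self_nonneg _
  have hstep : ∀ i Ω, a i ⬝ᵥ (S (insert i Ω) ^ (2 * k + 1)) *ᵥ a i -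
      a i ⬝ᵥ (S (Ω.erase i) ^ (2 * k + 1)) *ᵥ a i ≤
      κ * (a i ⬝ᵥ (S (insert i Ω) ^ (2 * k)) *ᵥ a i +
        a i ⬝ᵥ (S (Ω.erase i) ^ (2 * k)) *ᵥ a i) := by
    intro i Ω
    have h := trace_sub_mul_pow_sub_pow_le (hSh (insert i Ω)) (hSh (Ω.erase i)) k
    rw [hS, berSum_insert_sub_erase, ← hS] at h
    rw [smul_mul_assoc, trace_smul, smul_mul_smul_comm, smul_mul_assoc, trace_smul, mul_sub,
      trace_sub, vecMulVec_mul_vecMulVec, vecMulVec_smul, smul_mul_assoc, trace_smul, mul_add, trace_add] at h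
    simp only [trace_vecMulVec_mul, smul_eq_mul] at h
    set D := a i ⬝ᵥ (S (insert i Ω) ^ (2 * k + 1)) *ᵥ a i -
      a i ⬝ᵥ (S (Ω.erase i) ^ (2 * k + 1)) *ᵥ a i
    set G := a i ⬝ᵥ (S (insert i Ω) ^ (2 * k)) *ᵥ a i +
        a i ⬝ᵥ (S (Ω.erase i) ^ (2 * k)) *ᵥ a i with hG
    have hG0 : 0 ≤ G := add_nonneg (hnn _ _) (hnn _ _)
    have h2 := mul_le_mul_of_nonneg_left h h0.le
    have e1 : p * (1 / p * D) = D := by field_simp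
    rw [e1] at h2
    refine h2.trans ?_
    have e2 : p * ((2 * (k : ℝ) + 1) / 2 * (1 / p * (1 / p) * (a i ⬝ᵥ a i * G))) =
        (2 * k + 1) / 2 * (a i ⬝ᵥ a i / p) * G := by field_simp
    rw [e2, hκ]
    gcongr
    exact hR i
  have hcoord : ∀ i, berExp p (fun Ω => berDev p Ω i * (a i ⬝ᵥ (S Ω ^ (2 * k + 1)) *ᵥ a i)) ≤
      κ * berExp p (fun Ω => (2 + berDev p Ω i) * (a i ⬝ᵥ (S Ω ^ (2 * k)) *ᵥ a i)) := by
    intro i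
    rw [← berExp_const_mul, berExp_eq_coordinate p i, berExp_eq_coordinate p i (fun Ω => κ * _)]
    refine berExp_mono h0.le h1 fun Ω => ?_
    simp only [berDev_insert_self, berDev_erase_self]
    have h := mul_le_mul_of_nonneg_left (hstep i Ω) (sub_nonneg.2 h1)
    have hn := hnn i (insert i Ω)
    generalize a i ⬝ᵥ (S (insert i Ω) ^ (2 * k + 1)) *ᵥ a i = g1 at *
    generalize a i ⬝ᵥ (S (Ω.erase i) ^ (2 * k + 1)) *ᵥ a i = g0 at *
    generalize a i ⬝ᵥ (S (insert i Ω) ^ (2 * k)) *ᵥ a i = f1 at *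
    generalize a i ⬝ᵥ (S (Ω.erase i) ^ (2 * k)) *ᵥ a i = f0 at *
    have e1 : p * ((1 / p - 1) * g1) = (1 - p) * g1 := by field_simp
    have e2 : p * (κ * ((2 + (1 / p - 1)) * f1)) = (1 + p) * (κ * f1) := by field_simp; ring
    rw [e1, e2]
    have : 0 ≤ p * (κ * f1) := by positivity
    nlinarith
  have htr : ∀ Ω, ∀ l, trace (S Ω ^ (l + 1)) =
      ∑ i, berDev p Ω i * (a i ⬝ᵥ (S Ω ^ l) *ᵥ a i) := by
    intro Ω l
    rw [pow_succ']
    nth_rewrite 1 [hS]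
    rw [berSum, Finset.sum_mul, trace_sum]
    refine Finset.sum_congr rfl fun i _ => ?_
    rw [smul_mul_assoc, trace_smul, trace_vecMulVec_mul, smul_eq_mul]
  have hsum : ∀ Ω, ∑ i, a i ⬝ᵥ (S Ω ^ (2 * k)) *ᵥ a i ≤ B * trace (S Ω ^ (2 * k)) := by
    intro Ω
    have hT : (S Ω ^ k)ᵀ = S Ω ^ k := (hSh Ω).pow k
    calc ∑ i, a i ⬝ᵥ (S Ω ^ (2 * k)) *ᵥ a i
        = ∑ i, ∑ c, (a i ⬝ᵥ (S Ω ^ k) c) ^ 2 := by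
          refine Finset.sum_congr rfl fun i _ => ?_
          rw [dotProduct_pow_even_mulVec (hSh Ω)]
          refine Finset.sum_congr rfl fun c _ => ?_
          rw [mulVec, dotProduct_comm (a i), pow_two]
      _ = ∑ c, ∑ i, (a i ⬝ᵥ (S Ω ^ k) c) ^ 2 := Finset.sum_comm
      _ ≤ ∑ c, B * ((S Ω ^ k) c ⬝ᵥ (S Ω ^ k) c) := Finset.sum_le_sum fun c _ => hB _
      _ = B * trace (S Ω ^ (2 * k)) := by
          rw [← Finset.mul_sum, two_mul, pow_add]
          nth_rewrite 4 [← hT]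
          rfl
  have main : berExp p (fun Ω => trace (S Ω ^ (2 * (k + 1)))) ≤
      berExp p (fun Ω => trace (S Ω ^ (2 * (k + 1))) / 2 +
        (2 * κ * B + κ ^ 2 / 2) * trace (S Ω ^ (2 * k))) := by
    calc berExp p (fun Ω => trace (S Ω ^ (2 * (k + 1))))
        = ∑ i, berExp p (fun Ω => berDev p Ω i * (a i ⬝ᵥ (S Ω ^ (2 * k + 1)) *ᵥ a i)) := by
          rw [← berExp_sum]
          congr 1
          ext Ω
          exact htr Ω (2 * k + 1)
      _ ≤ ∑ i, κ * berExp p (fun Ω => (2 + berDev p Ω i) * (a i ⬝ᵥ (S Ω ^ (2 * k)) *ᵥ a i)) :=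
          Finset.sum_le_sum fun i _ => hcoord i
      _ = berExp p (fun Ω => κ * (2 * ∑ i, (a i ⬝ᵥ (S Ω ^ (2 * k)) *ᵥ a i) +
            trace (S Ω ^ (2 * k + 1)))) := by
          rw [← Finset.mul_sum, ← berExp_sum, ← berExp_const_mul]
          congr 1
          ext Ω
          rw [htr]
          congr 1
          rw [Finset.mul_sum, ← Finset.sum_add_distrib]
          exact Finset.sum_congr rfl fun i _ => by ring
      _ ≤ _ := by
          refine berExp_mono h0.le h1 fun Ω => ?_
          have t1 := trace_mul_pow_odd_le (hSh Ω) κ k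
          have t2 := mul_le_mul_of_nonneg_left (hsum Ω) hκ0
          rw [show 2 * (k + 1) = 2 * k + 2 by ring]
          nlinarith
  rw [berExp_add, berExp_const_mul] at main
  have e : berExp p (fun Ω => trace (S Ω ^ (2 * (k + 1))) / 2) =
      berExp p (fun Ω => trace (S Ω ^ (2 * (k + 1)))) / 2 := by
    simp only [div_eq_inv_mul]
    rw [berExp_const_mul]
  rw [e] at main
  have hM0 : 0 ≤ berExp p (fun Ω => trace (S Ω ^ (2 * k))) := by
    rw [← berExp_const (ι := ι) p 0]
    exact berExp_mono h0.le h1 fun Ω => trace_pow_even_nonneg (hSh Ω) k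
  have hc : 4 * κ * B + κ ^ 2 ≤ 4 * K * B + K ^ 2 := by gcongr
  nlinarith [mul_le_mul_of_nonneg_right hc hM0]

theorem berExp_trace_pow_le {p R B : ℝ} (h0 : 0 < p) (h1 : p ≤ 1) (a : ι → d → ℝ)
    (hR : ∀ i, a i ⬝ᵥ a i ≤ R) (hB : ∀ x : d → ℝ, ∑ i, (a i ⬝ᵥ x) ^ 2 ≤ B * (x ⬝ᵥ x))
    (hR0 : 0 ≤ R) (hB0 : 0 ≤ B) (q : ℕ) :
    berExp p (fun Ω => trace (berSum p a Ω ^ (2 * q))) ≤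
      (4 * (q * R / p) * B + (q * R / p) ^ 2) ^ q * Fintype.card d := by
  suffices h : ∀ k ≤ q, berExp p (fun Ω => trace (berSum p a Ω ^ (2 * k))) ≤
      (4 * (q * R / p) * B + (q * R / p) ^ 2) ^ k * Fintype.card d from h q le_rfl
  intro k
  induction k with
  | zero =>
    intro _
    simp [berExp_const]
  | succ k ih =>
    intro hk
    have hkq : ((k : ℝ) + 1) ≤ q := by exact_mod_cast hk
    refine (berExp_trace_pow_succ_le h0 h1 a hR hB hR0 hB0 k (K := q * R / p)
      (by gcongr)).trans ?_
    rw [pow_succ' (_ + _), mul_assoc (_ + _)]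
    exact mul_le_mul_of_nonneg_left (ih (by omega)) (by positivity)

/-- Concentration of random sums of rank-one matrices around their mean, in spectral norm. -/
theorem berPr_berSum_le {p R B : ℝ} (h0 : 0 < p) (h1 : p ≤ 1) (a : ι → d → ℝ)
    (hR : ∀ i, a i ⬝ᵥ a i ≤ R) (hB : ∀ x : d → ℝ, ∑ i, (a i ⬝ᵥ x) ^ 2 ≤ B * (x ⬝ᵥ x))
    (hR0 : 0 < R) (hB0 : 0 < B) {q : ℕ} (hq : q ≠ 0) (hqB : q * R / p ≤ B) {t : ℝ}
    (ht0 : 0 ≤ t) (ht : 40 * (q * R / p * B) ≤ t ^ 2) :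
    berPr p (fun Ω => ¬ ∀ x y : d → ℝ, |∑ i, berDev p Ω i * ((a i ⬝ᵥ x) * (a i ⬝ᵥ y))| ≤
      t * √(x ⬝ᵥ x) * √(y ⬝ᵥ y)) ≤ Fintype.card d * Real.exp (-(2 * q)) := by
  have hq0 : (0 : ℝ) < q := by exact_mod_cast Nat.pos_of_ne_zero hq
  set K : ℝ := q * R / p with hK
  have hK0 : 0 < K := by positivity
  have ht2 : 0 < t ^ 2 := lt_of_lt_of_le (by positivity) ht
  have hm := berPr_le_berExp h0.le h1
    (P := fun Ω => ¬ ∀ x y : d → ℝ, |∑ i, berDev p Ω i * ((a i ⬝ᵥ x) * (a i ⬝ᵥ y))| ≤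
      t * √(x ⬝ᵥ x) * √(y ⬝ᵥ y))
    (f := fun Ω => ((t ^ 2) ^ q)⁻¹ * trace (berSum p a Ω ^ (2 * q)))
    (fun Ω => mul_nonneg (by positivity) (trace_pow_even_nonneg (berSum_isHermitian p a Ω) q))
    (fun Ω hΩ => by
      by_contra hlt
      refine hΩ fun x y => ?_
      rw [← dotProduct_berSum_mulVec]
      refine abs_dotProduct_mulVec_le_of_trace_pow_le (berSum_isHermitian p a Ω) hq ht0 ?_ x y
      rw [not_le, inv_mul_lt_iff₀ (by positivity), mul_one] at hlt
      rw [pow_mul t]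
      exact hlt.le)
  refine hm.trans ?_
  rw [berExp_const_mul, inv_mul_le_iff₀ (by positivity)]
  refine (berExp_trace_pow_le h0 h1 a hR hB hR0.le hB0.le q).trans ?_
  rw [← hK]
  have hexp : Real.exp 1 ^ 2 ≤ 8 := by
    have := Real.exp_one_lt_d9
    nlinarith [Real.exp_pos 1]
  have hbase : 4 * K * B + K ^ 2 ≤ t ^ 2 * Real.exp (-2) := by
    have e : Real.exp (-2) * Real.exp 1 ^ 2 = 1 := by
      rw [← Real.exp_nat_mul, ← Real.exp_add]
      norm_num
    have h8 : 1 ≤ Real.exp (-2) * 8 := by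
      rw [← e]
      gcongr
    have h5 : 4 * K * B + K ^ 2 ≤ 5 * (K * B) := by nlinarith
    have := mul_le_mul_of_nonneg_right ht (Real.exp_pos (-2)).le
    nlinarith [mul_pos hK0 hB0]
  calc (4 * K * B + K ^ 2) ^ q * (Fintype.card d : ℝ)
      ≤ (t ^ 2 * Real.exp (-2)) ^ q * Fintype.card d := by gcongr
    _ = (t ^ 2) ^ q * (Fintype.card d * Real.exp (-(2 * q))) := by
        rw [mul_pow, ← Real.exp_nat_mul]
        ring_nf

end Moments

/-! ### Euclidean and spectral bounds -/

section Euclidean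

variable {m n r : Type*} [Fintype m] [Fintype n] [Fintype r]

theorem dotProduct_self_nonneg_real (x : m → ℝ) : 0 ≤ x ⬝ᵥ x :=
  Finset.sum_nonneg fun _ _ => mul_self_nonneg _

theorem abs_dotProduct_le (x y : m → ℝ) : |x ⬝ᵥ y| ≤ √(x ⬝ᵥ x) * √(y ⬝ᵥ y) := by
  rw [← Real.sqrt_mul (dotProduct_self_nonneg_real x)]
  refine Real.abs_le_sqrt ?_
  have := Finset.sum_mul_sq_le_sq_mul_sq Finset.univ x y
  simpa only [dotProduct, pow_two] using this

theorem sqrt_dotProduct_add_le (x y : m → ℝ) :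
    √((x + y) ⬝ᵥ (x + y)) ≤ √(x ⬝ᵥ x) + √(y ⬝ᵥ y) := by
  rw [Real.sqrt_le_left (by positivity), add_sq, Real.sq_sqrt (dotProduct_self_nonneg_real x),
    Real.sq_sqrt (dotProduct_self_nonneg_real y)]
  have := (abs_le.1 (abs_dotProduct_le x y)).2
  rw [add_dotProduct, dotProduct_add, dotProduct_add, dotProduct_comm y x]
  linarith

theorem sqrt_dotProduct_self_le_of_dual {x : m → ℝ} {s : ℝ}
    (h : ∀ y, x ⬝ᵥ y ≤ s * √(y ⬝ᵥ y)) (hs : 0 ≤ s) : √(x ⬝ᵥ x) ≤ s := by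
  have h1 := h x
  have h2 := Real.mul_self_sqrt (dotProduct_self_nonneg_real x)
  rcases (Real.sqrt_nonneg (x ⬝ᵥ x)).eq_or_lt with h0 | h0
  · rw [← h0]
    exact hs
  · exact le_of_mul_le_mul_right (by linarith) h0

theorem mulVec_dotProduct_mulVec_of_isometry [DecidableEq r] {U : Matrix m r ℝ}
    (hU : Uᵀ * U = 1) (v : r → ℝ) : (U *ᵥ v) ⬝ᵥ (U *ᵥ v) = v ⬝ᵥ v := by
  rw [dotProduct_mulVec, ← mulVec_transpose, mulVec_mulVec, hU, one_mulVec]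

theorem transpose_mulVec_dotProduct_le [DecidableEq r] {U : Matrix m r ℝ} (hU : Uᵀ * U = 1)
    (x : m → ℝ) : (Uᵀ *ᵥ x) ⬝ᵥ (Uᵀ *ᵥ x) ≤ x ⬝ᵥ x := by
  have h := dotProduct_self_nonneg_real (x - U *ᵥ (Uᵀ *ᵥ x))
  rw [sub_dotProduct, dotProduct_sub, dotProduct_sub, mulVec_dotProduct_mulVec_of_isometry hU,
    dotProduct_comm (U *ᵥ _) x] at h
  have e : x ⬝ᵥ U *ᵥ (Uᵀ *ᵥ x) = (Uᵀ *ᵥ x) ⬝ᵥ (Uᵀ *ᵥ x) := by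
    rw [dotProduct_mulVec, ← mulVec_transpose]
  linarith

theorem proj_compl_mulVec_dotProduct_le [DecidableEq m] [DecidableEq r] {U : Matrix m r ℝ}
    (hU : Uᵀ * U = 1) (x : m → ℝ) :
    ((1 - U * Uᵀ) *ᵥ x) ⬝ᵥ ((1 - U * Uᵀ) *ᵥ x) ≤ x ⬝ᵥ x := by
  have h := dotProduct_self_nonneg_real (Uᵀ *ᵥ x)
  have e : x ⬝ᵥ U *ᵥ (Uᵀ *ᵥ x) = (Uᵀ *ᵥ x) ⬝ᵥ (Uᵀ *ᵥ x) := by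
    rw [dotProduct_mulVec, ← mulVec_transpose]
  rw [sub_mulVec, one_mulVec, ← mulVec_mulVec, sub_dotProduct, dotProduct_sub, dotProduct_sub,
    mulVec_dotProduct_mulVec_of_isometry hU, dotProduct_comm (U *ᵥ _) x, e]
  linarith

/-- `M` has spectral norm at most `s`, in bilinear form. -/
def SpecLE (M : Matrix m n ℝ) (s : ℝ) : Prop :=
  ∀ x y, |x ⬝ᵥ M *ᵥ y| ≤ s * √(x ⬝ᵥ x) * √(y ⬝ᵥ y)

theorem SpecLE.mono {M : Matrix m n ℝ} {s t : ℝ} (h : SpecLE M s) (hst : s ≤ t) : SpecLE M t :=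
  fun x y => (h x y).trans (by gcongr)

theorem SpecLE.add {M N : Matrix m n ℝ} {s t : ℝ} (hM : SpecLE M s) (hN : SpecLE N t) :
    SpecLE (M + N) (s + t) := fun x y => by
  rw [add_mulVec, dotProduct_add, add_mul, add_mul]
  exact (abs_add_le _ _).trans (add_le_add (hM x y) (hN x y))

theorem SpecLE.neg {M : Matrix m n ℝ} {s : ℝ} (hM : SpecLE M s) : SpecLE (-M) s := fun x y => by
  rw [neg_mulVec, dotProduct_neg, abs_neg]
  exact hM x y

theorem SpecLE.sub {M N : Matrix m n ℝ} {s t : ℝ} (hM : SpecLE M s) (hN : SpecLE N t) :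
    SpecLE (M - N) (s + t) := by
  rw [sub_eq_add_neg]
  exact hM.add hN.neg

theorem SpecLE.transpose {M : Matrix m n ℝ} {s : ℝ} (hM : SpecLE M s) : SpecLE Mᵀ s :=
  fun x y => by
    rw [mulVec_transpose, dotProduct_comm, ← dotProduct_mulVec, mul_right_comm]
    exact hM y x

theorem SpecLE.mul_mul {k l : Type*} [Fintype k] [Fintype l] {M : Matrix m n ℝ} {s : ℝ}
    (hM : SpecLE M s) (hs : 0 ≤ s) {P : Matrix k m ℝ} {Q : Matrix n l ℝ}
    (hP : ∀ x, (Pᵀ *ᵥ x) ⬝ᵥ (Pᵀ *ᵥ x) ≤ x ⬝ᵥ x) (hQ : ∀ x, (Q *ᵥ x) ⬝ᵥ (Q *ᵥ x) ≤ x ⬝ᵥ x) :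
    SpecLE (P * M * Q) s := fun x y => by
  rw [← mulVec_mulVec, ← mulVec_mulVec, dotProduct_mulVec x P, ← mulVec_transpose]
  refine (hM _ _).trans ?_
  gcongr
  · exact hP x
  · exact hQ y

theorem SpecLE.sqrt_mulVec_le {M : Matrix m n ℝ} {s : ℝ} (hM : SpecLE M s) (hs : 0 ≤ s)
    (y : n → ℝ) : √((M *ᵥ y) ⬝ᵥ (M *ᵥ y)) ≤ s * √(y ⬝ᵥ y) := by
  refine sqrt_dotProduct_self_le_of_dual (fun x => ?_) (by positivity)
  rw [dotProduct_comm, mul_right_comm]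
  exact (le_abs_self _).trans (hM x y)

theorem sqrt_sum_rescaled_columns_le {A : Matrix m r ℝ} {α : ℝ} (hα : 0 ≤ α)
    (hA : ∀ i, √(A i ⬝ᵥ A i) ≤ α) (x : m → ℝ) :
    √(∑ k, √((fun i => x i * A i k) ⬝ᵥ (fun i => x i * A i k)) ^ 2) ≤ α * √(x ⬝ᵥ x) := by
  rw [Real.sqrt_le_left (by positivity), mul_pow, Real.sq_sqrt (dotProduct_self_nonneg_real x)]
  simp only [Real.sq_sqrt (dotProduct_self_nonneg_real _)]
  simp only [dotProduct]
  rw [Finset.sum_comm, Finset.mul_sum]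
  refine Finset.sum_le_sum fun i _ => ?_
  have h : A i ⬝ᵥ A i ≤ α ^ 2 := (Real.sqrt_le_left hα).1 (hA i)
  calc ∑ k, x i * A i k * (x i * A i k) = x i ^ 2 * (A i ⬝ᵥ A i) := by
        rw [dotProduct, Finset.mul_sum]
        exact Finset.sum_congr rfl fun _ _ => by ring
    _ ≤ x i ^ 2 * α ^ 2 := by gcongr
    _ = α ^ 2 * (x i * x i) := by ring

/-- Schur multiplier bound for a product of two matrices with bounded rows. -/
theorem SpecLE.hadamard_mul_transpose {X : Matrix m n ℝ} {b α β : ℝ} (hX : SpecLE X b)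
    (hb : 0 ≤ b) (hα : 0 ≤ α) (hβ : 0 ≤ β) {A : Matrix m r ℝ} {B : Matrix n r ℝ}
    (hA : ∀ i, √(A i ⬝ᵥ A i) ≤ α) (hB : ∀ j, √(B j ⬝ᵥ B j) ≤ β) :
    SpecLE (X ⊙ (A * Bᵀ)) (b * (α * β)) := by
  intro x y
  have e : x ⬝ᵥ (X ⊙ (A * Bᵀ)) *ᵥ y =
      ∑ k, (fun i => x i * A i k) ⬝ᵥ X *ᵥ (fun j => y j * B j k) := by
    simp only [dotProduct, mulVec, hadamard_apply, mul_apply, transpose_apply, Finset.mul_sum,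
      Finset.sum_mul]
    rw [Finset.sum_comm_cycle]
    refine Finset.sum_congr rfl fun k _ => ?_
    exact Finset.sum_congr rfl fun i _ => Finset.sum_congr rfl fun j _ => by ring
  rw [e]
  calc |∑ k, (fun i => x i * A i k) ⬝ᵥ X *ᵥ (fun j => y j * B j k)|
      ≤ ∑ k, b * √((fun i => x i * A i k) ⬝ᵥ (fun i => x i * A i k)) *
          √((fun j => y j * B j k) ⬝ᵥ (fun j => y j * B j k)) :=
        (Finset.abs_sum_le_sum_abs _ _).trans (Finset.sum_le_sum fun k _ => hX _ _)
    _ = b * ∑ k, √((fun i => x i * A i k) ⬝ᵥ (fun i => x i * A i k)) *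
          √((fun j => y j * B j k) ⬝ᵥ (fun j => y j * B j k)) := by
        rw [Finset.mul_sum]
        exact Finset.sum_congr rfl fun _ _ => by ring
    _ ≤ b * ((α * √(x ⬝ᵥ x)) * (β * √(y ⬝ᵥ y))) := by
        refine mul_le_mul_of_nonneg_left ?_ hb
        refine (Real.sum_mul_le_sqrt_mul_sqrt _ _ _).trans ?_
        exact mul_le_mul (sqrt_sum_rescaled_columns_le hα hA x)
          (sqrt_sum_rescaled_columns_le hβ hB y) (Real.sqrt_nonneg _) (by positivity)
    _ = b * (α * β) * √(x ⬝ᵥ x) * √(y ⬝ᵥ y) := by ring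

end Euclidean

theorem specNorm_le {m n : ℕ} {M : Matrix (Fin m) (Fin n) ℝ} {s : ℝ} (hM : SpecLE M s)
    (hs : 0 ≤ s) : specNorm M ≤ s := by
  refine Real.iSup_le (fun i => ?_) hs
  set hH := Matrix.isHermitian_conjTranspose_mul_self M
  set v : Fin n → ℝ := (hH.eigenvectorBasis i).ofLp with hv
  have hvv : v ⬝ᵥ v = 1 := by
    have h := hH.eigenvectorBasis.orthonormal.1 i
    have h2 := EuclideanSpace.real_norm_sq_eq (hH.eigenvectorBasis i)
    rw [h] at h2
    simp only [dotProduct, ← pow_two]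
    rw [← h2]
    norm_num
  have hev := hH.mulVec_eigenvectorBasis i
  have e : hH.eigenvalues i = (M *ᵥ v) ⬝ᵥ (M *ᵥ v) := by
    have h3 := congrArg (fun w => v ⬝ᵥ w) hev
    simp only [dotProduct_smul] at h3
    change v ⬝ᵥ (Mᵀ * M) *ᵥ v = _ • (v ⬝ᵥ v) at h3
    rw [hvv, smul_eq_mul, mul_one] at h3
    rw [← h3, ← mulVec_mulVec, dotProduct_mulVec, vecMul_transpose]
  rw [e]
  simpa [hvv] using hM.sqrt_mulVec_le hs v

/-! ### The Frobenius inner product and the projections onto `T` -/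

section Frobenius

variable {m n : ℕ}

/-- The Frobenius inner product. -/
def frobInner (X Y : Matrix (Fin m) (Fin n) ℝ) : ℝ := ∑ i, ∑ j, X i j * Y i j

theorem frobInner_eq_trace (X Y : Matrix (Fin m) (Fin n) ℝ) :
    frobInner X Y = trace (X * Yᵀ) := rfl

theorem frobInner_eq_dotProduct (X Y : Matrix (Fin m) (Fin n) ℝ) :
    frobInner X Y = (fun x : Fin m × Fin n => X x.1 x.2) ⬝ᵥ (fun x => Y x.1 x.2) := by
  rw [dotProduct, Fintype.sum_prod_type]
  rfl

theorem frobNorm_eq (X : Matrix (Fin m) (Fin n) ℝ) : frobNorm X = √(frobInner X X) := by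
  simp only [frobNorm, frobInner, pow_two]

theorem frobNorm_nonneg (X : Matrix (Fin m) (Fin n) ℝ) : 0 ≤ frobNorm X := Real.sqrt_nonneg _

theorem frobInner_self_nonneg (X : Matrix (Fin m) (Fin n) ℝ) : 0 ≤ frobInner X X :=
  Finset.sum_nonneg fun _ _ => Finset.sum_nonneg fun _ _ => mul_self_nonneg _

theorem frobNorm_sq (X : Matrix (Fin m) (Fin n) ℝ) : frobNorm X ^ 2 = frobInner X X := by
  rw [frobNorm_eq, Real.sq_sqrt (frobInner_self_nonneg X)]

theorem frobInner_comm (X Y : Matrix (Fin m) (Fin n) ℝ) : frobInner X Y = frobInner Y X := by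
  simp only [frobInner, mul_comm]

theorem abs_frobInner_le (X Y : Matrix (Fin m) (Fin n) ℝ) :
    |frobInner X Y| ≤ frobNorm X * frobNorm Y := by
  simp only [frobNorm_eq, frobInner_eq_dotProduct]
  exact abs_dotProduct_le _ _

theorem frobNorm_add_le (X Y : Matrix (Fin m) (Fin n) ℝ) :
    frobNorm (X + Y) ≤ frobNorm X + frobNorm Y := by
  simp only [frobNorm_eq, frobInner_eq_dotProduct]
  exact sqrt_dotProduct_add_le _ _

theorem frobNorm_neg (X : Matrix (Fin m) (Fin n) ℝ) : frobNorm (-X) = frobNorm X := by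
  simp [frobNorm]

theorem frobNorm_transpose (X : Matrix (Fin m) (Fin n) ℝ) : frobNorm Xᵀ = frobNorm X := by
  simp only [frobNorm, transpose_apply]
  rw [Finset.sum_comm]

theorem eq_zero_of_frobNorm_eq_zero {X : Matrix (Fin m) (Fin n) ℝ} (h : frobNorm X = 0) :
    X = 0 := by
  have h2 := frobNorm_sq X
  rw [h, frobInner_eq_dotProduct] at h2
  have h3 := dotProduct_self_eq_zero.1 (h2.symm.trans (by norm_num))
  ext i j
  exact congrFun h3 (i, j)

theorem frobNorm_vecMulVec (x : Fin m → ℝ) (y : Fin n → ℝ) :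
    frobNorm (vecMulVec x y) = √(x ⬝ᵥ x) * √(y ⬝ᵥ y) := by
  rw [frobNorm, ← Real.sqrt_mul (dotProduct_self_nonneg_real x)]
  congr 1
  simp only [dotProduct, Finset.sum_mul_sum, vecMulVec_apply]
  exact Finset.sum_congr rfl fun _ _ => Finset.sum_congr rfl fun _ _ => by ring

theorem dotProduct_mulVec_eq_frobInner (M : Matrix (Fin m) (Fin n) ℝ) (x : Fin m → ℝ)
    (y : Fin n → ℝ) : x ⬝ᵥ M *ᵥ y = frobInner M (vecMulVec x y) := by
  simp only [dotProduct, mulVec, frobInner, vecMulVec_apply, Finset.mul_sum]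
  exact Finset.sum_congr rfl fun _ _ => Finset.sum_congr rfl fun _ _ => by ring

theorem specLE_frobNorm (M : Matrix (Fin m) (Fin n) ℝ) : SpecLE M (frobNorm M) := fun x y => by
  rw [dotProduct_mulVec_eq_frobInner, mul_assoc, ← frobNorm_vecMulVec]
  exact abs_frobInner_le _ _

theorem frobInner_mul_left (A : Matrix (Fin m) (Fin m) ℝ) (X Y : Matrix (Fin m) (Fin n) ℝ) :
    frobInner (A * X) Y = frobInner X (Aᵀ * Y) := by
  simp only [frobInner_eq_trace, transpose_mul, transpose_transpose, Matrix.mul_assoc]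
  rw [trace_mul_comm, Matrix.mul_assoc]

theorem frobInner_mul_right (B : Matrix (Fin n) (Fin n) ℝ) (X Y : Matrix (Fin m) (Fin n) ℝ) :
    frobInner (X * B) Y = frobInner X (Y * Bᵀ) := by
  simp only [frobInner_eq_trace, transpose_mul, transpose_transpose, Matrix.mul_assoc]

end Frobenius

section Projection

variable {m n r : ℕ} (U : Matrix (Fin m) (Fin r) ℝ) (V : Matrix (Fin n) (Fin r) ℝ)

theorem PT_add (X Y : Matrix (Fin m) (Fin n) ℝ) : PT U V (X + Y) = PT U V X + PT U V Y := by
  simp only [PT, Matrix.mul_add, Matrix.add_mul]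
  abel

theorem PT_smul (c : ℝ) (X : Matrix (Fin m) (Fin n) ℝ) : PT U V (c • X) = c • PT U V X := by
  simp only [PT, Matrix.mul_smul, Matrix.smul_mul, smul_add, smul_sub]

theorem PT_sub (X Y : Matrix (Fin m) (Fin n) ℝ) : PT U V (X - Y) = PT U V X - PT U V Y := by
  simp only [PT, Matrix.mul_sub, Matrix.sub_mul]
  abel

theorem PTperp_add (X Y : Matrix (Fin m) (Fin n) ℝ) :
    PTperp U V (X + Y) = PTperp U V X + PTperp U V Y := by
  simp only [PTperp, Matrix.mul_add, Matrix.add_mul]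

theorem PTperp_eq_sub (X : Matrix (Fin m) (Fin n) ℝ) : PTperp U V X = X - PT U V X := by
  simp only [PT, PTperp, Matrix.mul_sub, Matrix.sub_mul, Matrix.mul_one, Matrix.one_mul]
  abel

theorem PT_transpose (X : Matrix (Fin m) (Fin n) ℝ) : (PT U V X)ᵀ = PT V U Xᵀ := by
  simp only [PT, transpose_add, transpose_sub, transpose_mul, transpose_transpose,
    Matrix.mul_assoc]
  abel

theorem frobInner_add_right (X Y Z : Matrix (Fin m) (Fin n) ℝ) :
    frobInner X (Y + Z) = frobInner X Y + frobInner X Z := by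
  simp [frobInner, mul_add, Finset.sum_add_distrib]

theorem frobInner_sub_right (X Y Z : Matrix (Fin m) (Fin n) ℝ) :
    frobInner X (Y - Z) = frobInner X Y - frobInner X Z := by
  simp [frobInner, mul_sub, Finset.sum_sub_distrib]

theorem frobInner_PT (X Y : Matrix (Fin m) (Fin n) ℝ) :
    frobInner (PT U V X) Y = frobInner X (PT U V Y) := by
  have hS : ∀ {k : ℕ} (W : Matrix (Fin k) (Fin r) ℝ), (W * Wᵀ)ᵀ = W * Wᵀ := fun W => by
    rw [transpose_mul, transpose_transpose]
  have e1 := frobInner_mul_left (U * Uᵀ) X Y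
  have e2 := frobInner_mul_right (V * Vᵀ) X Y
  have e3 := frobInner_mul_right (V * Vᵀ) (U * Uᵀ * X) Y
  have e4 := frobInner_mul_left (U * Uᵀ) X (Y * (V * Vᵀ))
  rw [hS] at e1 e2 e3 e4
  rw [frobInner_comm, PT, PT, frobInner_sub_right, frobInner_add_right, frobInner_sub_right,
    frobInner_add_right, frobInner_comm Y, frobInner_comm Y, frobInner_comm Y, e1, e2, e3, e4,
    Matrix.mul_assoc (U * Uᵀ) Y]

variable {U V}

theorem PT_PT (hU : Uᵀ * U = 1) (hV : Vᵀ * V = 1) (X : Matrix (Fin m) (Fin n) ℝ) :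
    PT U V (PT U V X) = PT U V X := by
  have hU' : ∀ Z : Matrix (Fin r) (Fin n) ℝ, Uᵀ * (U * Z) = Z := fun Z => by
    rw [← Matrix.mul_assoc, hU, Matrix.one_mul]
  have hV' : ∀ Z : Matrix (Fin r) (Fin n) ℝ, Vᵀ * (V * Z) = Z := fun Z => by
    rw [← Matrix.mul_assoc, hV, Matrix.one_mul]
  simp only [PT, Matrix.mul_add, Matrix.add_mul, Matrix.mul_sub, Matrix.sub_mul, Matrix.mul_assoc,
    hU', hV']
  abel

theorem memT_iff (hU : Uᵀ * U = 1) (hV : Vᵀ * V = 1) (X : Matrix (Fin m) (Fin n) ℝ) :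
    memT U V X ↔ PT U V X = X := by
  constructor
  · rintro ⟨A, B, rfl⟩
    have hU' : ∀ {k : ℕ} (Z : Matrix (Fin r) (Fin k) ℝ), Uᵀ * (U * Z) = Z := fun Z => by
      rw [← Matrix.mul_assoc, hU, Matrix.one_mul]
    have hV' : ∀ {k : ℕ} (Z : Matrix (Fin r) (Fin k) ℝ), Vᵀ * (V * Z) = Z := fun Z => by
      rw [← Matrix.mul_assoc, hV, Matrix.one_mul]
    simp only [PT, Matrix.mul_add, Matrix.add_mul, Matrix.mul_assoc, hU', hV']
    abel
  · intro h
    refine ⟨(Uᵀ * X)ᵀ, X * V - U * (Uᵀ * (X * V)), ?_⟩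
    conv_lhs => rw [← h]
    simp only [PT, transpose_transpose, Matrix.sub_mul, Matrix.mul_assoc]
    abel

theorem PTperp_PT (hU : Uᵀ * U = 1) (hV : Vᵀ * V = 1) (X : Matrix (Fin m) (Fin n) ℝ) :
    PTperp U V (PT U V X) = 0 := by
  rw [PTperp_eq_sub, PT_PT hU hV, sub_self]

theorem frobNorm_PT_le (hU : Uᵀ * U = 1) (hV : Vᵀ * V = 1) (X : Matrix (Fin m) (Fin n) ℝ) :
    frobNorm (PT U V X) ≤ frobNorm X := by
  have h := abs_frobInner_le X (PT U V X)
  have e : frobInner X (PT U V X) = frobNorm (PT U V X) ^ 2 := by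
    rw [frobNorm_sq, frobInner_PT, PT_PT hU hV]
  rw [e, abs_of_nonneg (sq_nonneg _)] at h
  nlinarith [frobNorm_nonneg X, frobNorm_nonneg (PT U V X)]

theorem transpose_mul_PT_mul (hU : Uᵀ * U = 1) (hV : Vᵀ * V = 1) (X : Matrix (Fin m) (Fin n) ℝ) :
    Uᵀ * PT U V X * V = Uᵀ * X * V := by
  have hU' : ∀ Z : Matrix (Fin r) (Fin r) ℝ, Uᵀ * (U * Z) = Z := fun Z => by
    rw [← Matrix.mul_assoc, hU, Matrix.one_mul]
  simp only [PT, Matrix.mul_add, Matrix.add_mul, Matrix.mul_sub, Matrix.sub_mul, Matrix.mul_assoc,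
    hU', hV, Matrix.mul_one]
  abel

theorem PT_eq_add (hU : Uᵀ * U = 1) (hV : Vᵀ * V = 1) (X : Matrix (Fin m) (Fin n) ℝ) :
    PT U V X = U * (Uᵀ * PT U V X * (1 - V * Vᵀ)) + X * V * Vᵀ := by
  have hU' : ∀ Z : Matrix (Fin r) (Fin n) ℝ, Uᵀ * (U * Z) = Z := fun Z => by
    rw [← Matrix.mul_assoc, hU, Matrix.one_mul]
  have hV' : ∀ Z : Matrix (Fin r) (Fin n) ℝ, Vᵀ * (V * Z) = Z := fun Z => by
    rw [← Matrix.mul_assoc, hV, Matrix.one_mul]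
  simp only [PT, Matrix.mul_add, Matrix.add_mul, Matrix.mul_sub, Matrix.sub_mul, Matrix.mul_assoc,
    hU', hV', Matrix.mul_one]
  abel

theorem PT_mul_transpose (hU : Uᵀ * U = 1) (hV : Vᵀ * V = 1) : PT U V (U * Vᵀ) = U * Vᵀ :=
  (memT_iff hU hV _).1 ⟨0, U, by simp⟩

theorem PT_vecMulVec_mulVec (hU : Uᵀ * U = 1) (hV : Vᵀ * V = 1) (x : Fin m → ℝ) (v : Fin r → ℝ) :
    PT U V (vecMulVec x (V *ᵥ v)) = vecMulVec x (V *ᵥ v) := by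
  refine (memT_iff hU hV _).1 ⟨0, vecMulVec x v, ?_⟩
  rw [transpose_zero, Matrix.mul_zero, zero_add, vecMulVec_mul, vecMul_transpose]

end Projection

/-! ### The deterministic estimate for the dual certificate -/

section Deterministic

variable {m n r : ℕ}

/-- The quadratic form of `X ↦ PT (ξ ⊙ PT X)` is bounded by `a`. -/
def RestrictedLE (U : Matrix (Fin m) (Fin r) ℝ) (V : Matrix (Fin n) (Fin r) ℝ)
    (ξ : Matrix (Fin m) (Fin n) ℝ) (a : ℝ) : Prop :=
  ∀ X Y, |∑ i, ∑ j, ξ i j * (PT U V X i j * PT U V Y i j)| ≤ a * frobNorm X * frobNorm Y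

/-- The properties of the centred and rescaled sampling pattern `ξ` used in the estimate. -/
structure GoodPattern (U : Matrix (Fin m) (Fin r) ℝ) (V : Matrix (Fin n) (Fin r) ℝ)
    (ξ : Matrix (Fin m) (Fin n) ℝ) (a b γ t : ℝ) : Prop where
  restricted : RestrictedLE U V ξ a
  spec : SpecLE ξ b
  specSign : SpecLE (ξ ⊙ (U * Vᵀ)) γ
  entry : ∀ i j, |PT U V (ξ ⊙ (U * Vᵀ)) i j| ≤ t
  rowSum : ∀ i, ∑ j, ξ i j ≤ n
  colSum : ∀ j, ∑ i, ξ i j ≤ m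

theorem hadamard_sub_right (ξ X Y : Matrix (Fin m) (Fin n) ℝ) :
    ξ ⊙ (X - Y) = ξ ⊙ X - ξ ⊙ Y := by
  ext i j
  simp [mul_sub]

variable {U : Matrix (Fin m) (Fin r) ℝ} {V : Matrix (Fin n) (Fin r) ℝ}
  {ξ : Matrix (Fin m) (Fin n) ℝ} {a : ℝ}

theorem RestrictedLE.transpose (h : RestrictedLE U V ξ a) : RestrictedLE V U ξᵀ a := by
  intro X Y
  have := h Xᵀ Yᵀ
  rw [frobNorm_transpose, frobNorm_transpose, ← PT_transpose, ← PT_transpose,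
    Finset.sum_comm] at this
  exact this

theorem RestrictedLE.abs_sum_le (h : RestrictedLE U V ξ a) {X Y : Matrix (Fin m) (Fin n) ℝ}
    (hX : PT U V X = X) (hY : PT U V Y = Y) :
    |∑ i, ∑ j, ξ i j * (X i j * Y i j)| ≤ a * frobNorm X * frobNorm Y := by
  have := h X Y
  rwa [hX, hY] at this

theorem RestrictedLE.frobNorm_PT_hadamard_le (hU : Uᵀ * U = 1) (hV : Vᵀ * V = 1)
    (h : RestrictedLE U V ξ a) (ha : 0 ≤ a) {X : Matrix (Fin m) (Fin n) ℝ}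
    (hX : PT U V X = X) : frobNorm (PT U V (ξ ⊙ X)) ≤ a * frobNorm X := by
  set K := PT U V (ξ ⊙ X) with hK
  have hKT : PT U V K = K := PT_PT hU hV _
  have e : frobNorm K ^ 2 = ∑ i, ∑ j, ξ i j * (X i j * K i j) := by
    rw [frobNorm_sq]
    nth_rewrite 1 [hK]
    rw [frobInner_PT, hKT]
    simp only [frobInner, hadamard_apply, mul_assoc]
  have h1 := (le_abs_self _).trans (h.abs_sum_le hX hKT)
  rw [← e, pow_two] at h1
  rcases (frobNorm_nonneg K).eq_or_lt with h0 | h0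
  · rw [← h0]
    exact mul_nonneg ha (frobNorm_nonneg X)
  · exact le_of_mul_le_mul_right h1 h0

theorem specLE_hadamard_of_PT_eq (hU : Uᵀ * U = 1) (hV : Vᵀ * V = 1) {b u v R C κ : ℝ}
    (hξ : SpecLE ξ b) (hb : 0 ≤ b) (hu : 0 ≤ u) (hv : 0 ≤ v) (hR : 0 ≤ R) (hC : 0 ≤ C)
    (hκ : 0 ≤ κ) (hUu : ∀ i, √(U i ⬝ᵥ U i) ≤ u) (hVv : ∀ j, √(V j ⬝ᵥ V j) ≤ v)
    {Z : Matrix (Fin m) (Fin n) ℝ} (hZ : PT U V Z = Z) (hrow : ∀ i, √(Z i ⬝ᵥ Z i) ≤ R)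
    (hcol : ∀ j, √(Zᵀ j ⬝ᵥ Zᵀ j) ≤ C) (hcore : SpecLE (Uᵀ * Z * V) κ) :
    SpecLE (ξ ⊙ Z) (b * (u * C) + b * (R * v) + b * (κ * u * v)) := by
  have e : ξ ⊙ Z = ξ ⊙ (U * (Zᵀ * U)ᵀ) + ξ ⊙ (Z * V * Vᵀ) - ξ ⊙ (U * (Uᵀ * Z * V) * Vᵀ) := by
    conv_lhs => rw [← hZ]
    rw [← hadamard_add, ← hadamard_sub_right]
    simp only [PT, transpose_mul, transpose_transpose, Matrix.mul_assoc]
  rw [e]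
  refine ((hξ.hadamard_mul_transpose hb hu hC hUu fun j => ?_).add
    (hξ.hadamard_mul_transpose hb hR hv (fun i => ?_) hVv)).sub
    (hξ.hadamard_mul_transpose hb (by positivity) hv (fun i => ?_) hVv)
  · rw [mul_apply_eq_vecMul, ← mulVec_transpose]
    exact (Real.sqrt_le_sqrt (transpose_mulVec_dotProduct_le hU _)).trans (hcol j)
  · rw [mul_apply_eq_vecMul, ← mulVec_transpose]
    exact (Real.sqrt_le_sqrt (transpose_mulVec_dotProduct_le hV _)).trans (hrow i)
  · rw [mul_apply_eq_vecMul, ← mulVec_transpose]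
    refine (hcore.transpose.sqrt_mulVec_le hκ _).trans ?_
    gcongr
    exact hUu i

theorem RestrictedLE.sum_row_mul_sq_le (hU : Uᵀ * U = 1) (hV : Vᵀ * V = 1)
    (h : RestrictedLE U V ξ a) (i : Fin m) (v : Fin r → ℝ) :
    ∑ j, ξ i j * (V *ᵥ v) j ^ 2 ≤ a * (v ⬝ᵥ v) := by
  have hT := PT_vecMulVec_mulVec hU hV (Pi.single i (1 : ℝ)) v
  have h1 := (le_abs_self _).trans (h.abs_sum_le hT hT)
  rw [mul_assoc, ← pow_two, frobNorm_vecMulVec, mulVec_dotProduct_mulVec_of_isometry hV,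
    single_dotProduct, Pi.single_eq_same, one_mul, Real.sqrt_one, one_mul,
    Real.sq_sqrt (dotProduct_self_nonneg_real v), Finset.sum_eq_single i] at h1
  · refine le_trans (le_of_eq (Finset.sum_congr rfl fun j _ => ?_)) h1
    rw [vecMulVec_apply, Pi.single_eq_same]
    ring
  · intro k _ hk
    refine Finset.sum_eq_zero fun j _ => ?_
    rw [vecMulVec_apply, Pi.single_eq_of_ne hk]
    ring
  · simp

theorem RestrictedLE.sqrt_row_PT_hadamard_le (hU : Uᵀ * U = 1) (hV : Vᵀ * V = 1)
    (h : RestrictedLE U V ξ a) (ha : a ≤ 1) (hξ : ∀ i j, -1 ≤ ξ i j) {u t : ℝ} (ht : 0 ≤ t)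
    (hUu : ∀ i, √(U i ⬝ᵥ U i) ≤ u) {W : Matrix (Fin m) (Fin n) ℝ} (hW : ∀ i j, |W i j| ≤ t)
    {i : Fin m} (hrow : ∑ j, ξ i j ≤ n) :
    √(PT U V (ξ ⊙ W) i ⬝ᵥ PT U V (ξ ⊙ W) i) ≤
      u * frobNorm (PT U V (ξ ⊙ W)) + 3 * √n * t := by
  set Z := PT U V (ξ ⊙ W) with hZ
  have habs : ∀ j, |ξ i j| ≤ ξ i j + 2 := fun j => by
    have := hξ i j
    rw [abs_le]
    constructor <;> linarith
  have hcore : SpecLE (Uᵀ * Z * (1 - V * Vᵀ)) (frobNorm Z) :=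
    (specLE_frobNorm Z).mul_mul (frobNorm_nonneg Z)
      (fun x => by
        rw [transpose_transpose, mulVec_dotProduct_mulVec_of_isometry hU])
      (proj_compl_mulVec_dotProduct_le hV)
  have hcol : √((Vᵀ *ᵥ (ξ ⊙ W) i) ⬝ᵥ (Vᵀ *ᵥ (ξ ⊙ W) i)) ≤ 3 * √n * t := by
    refine sqrt_dotProduct_self_le_of_dual (fun v => ?_) (by positivity)
    set w := V *ᵥ v with hw
    have hww : w ⬝ᵥ w = v ⬝ᵥ v := mulVec_dotProduct_mulVec_of_isometry hV v
    have s1 : ∑ j, |ξ i j| ≤ 3 * n := by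
      calc ∑ j, |ξ i j| ≤ ∑ j, (ξ i j + 2) := Finset.sum_le_sum fun j _ => habs j
        _ = ∑ j, ξ i j + 2 * n := by
            rw [Finset.sum_add_distrib]
            simp [mul_comm]
        _ ≤ 3 * n := by linarith
    have s2 : ∑ j, |ξ i j| * w j ^ 2 ≤ 3 * (v ⬝ᵥ v) := by
      calc ∑ j, |ξ i j| * w j ^ 2 ≤ ∑ j, (ξ i j * w j ^ 2 + 2 * (w j * w j)) :=
            Finset.sum_le_sum fun j _ => by nlinarith [habs j, sq_nonneg (w j)]
        _ = ∑ j, ξ i j * w j ^ 2 + 2 * (w ⬝ᵥ w) := by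
            rw [Finset.sum_add_distrib, ← Finset.mul_sum]
            rfl
        _ ≤ a * (v ⬝ᵥ v) + 2 * (v ⬝ᵥ v) := by
            rw [hww]
            exact add_le_add_left (h.sum_row_mul_sq_le hU hV i v) _
        _ ≤ 3 * (v ⬝ᵥ v) := by nlinarith [dotProduct_self_nonneg_real v]
    have s3 : ∑ j, |ξ i j| * |w j| ≤ √(3 * n) * √(3 * (v ⬝ᵥ v)) := by
      calc ∑ j, |ξ i j| * |w j| = ∑ j, √|ξ i j| * (√|ξ i j| * |w j|) := by
            refine Finset.sum_congr rfl fun j _ => ?_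
            rw [← mul_assoc, Real.mul_self_sqrt (abs_nonneg _)]
        _ ≤ √(∑ j, √|ξ i j| ^ 2) * √(∑ j, (√|ξ i j| * |w j|) ^ 2) :=
            Real.sum_mul_le_sqrt_mul_sqrt _ _ _
        _ ≤ √(3 * n) * √(3 * (v ⬝ᵥ v)) := by
            simp only [mul_pow, Real.sq_sqrt (abs_nonneg _), sq_abs]
            gcongr
    calc (Vᵀ *ᵥ (ξ ⊙ W) i) ⬝ᵥ v = ∑ j, ξ i j * W i j * w j := by
          rw [mulVec_transpose, ← dotProduct_mulVec]
          rfl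
      _ ≤ ∑ j, t * (|ξ i j| * |w j|) := by
          refine Finset.sum_le_sum fun j _ => (le_abs_self _).trans ?_
          rw [abs_mul, abs_mul]
          nlinarith [mul_le_mul_of_nonneg_right (hW i j)
            (mul_nonneg (abs_nonneg (ξ i j)) (abs_nonneg (w j)))]
      _ ≤ t * (√(3 * n) * √(3 * (v ⬝ᵥ v))) := by
          rw [← Finset.mul_sum]
          gcongr
      _ = 3 * √n * t * √(v ⬝ᵥ v) := by
          rw [Real.sqrt_mul (by norm_num), Real.sqrt_mul (by norm_num)]
          have := Real.mul_self_sqrt (show (0 : ℝ) ≤ 3 by norm_num)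
          linear_combination t * √n * √(v ⬝ᵥ v) * this
  have e : Z i = (Uᵀ * Z * (1 - V * Vᵀ))ᵀ *ᵥ U i + V *ᵥ (Vᵀ *ᵥ (ξ ⊙ W) i) := by
    have h1 := congrFun (PT_eq_add hU hV (ξ ⊙ W)) i
    rw [← hZ] at h1
    change Z i = (U * (Uᵀ * Z * (1 - V * Vᵀ)) : Matrix (Fin m) (Fin n) ℝ) i +
      ((ξ ⊙ W) * V * Vᵀ : Matrix (Fin m) (Fin n) ℝ) i at h1
    rw [mul_apply_eq_vecMul, mul_apply_eq_vecMul, mul_apply_eq_vecMul] at h1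
    rw [mulVec_transpose, mulVec_transpose, ← vecMul_transpose]
    exact h1
  rw [e]
  refine (sqrt_dotProduct_add_le _ _).trans (add_le_add ?_ ?_)
  · refine (hcore.transpose.sqrt_mulVec_le (frobNorm_nonneg Z) _).trans ?_
    rw [mul_comm]
    exact mul_le_mul_of_nonneg_right (hUu i) (frobNorm_nonneg Z)
  · rw [mulVec_dotProduct_mulVec_of_isometry hV]
    exact hcol

theorem RestrictedLE.frobNorm_add_hadamard_le (h : RestrictedLE U V ξ a) (ha : a ≤ 1) {p : ℝ}
    (hp : 0 < p) (hξ : ∀ i j, (1 + ξ i j) ^ 2 = (1 + ξ i j) / p)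
    {N : Matrix (Fin m) (Fin n) ℝ} (hN : PT U V N = N) :
    frobNorm (N + ξ ⊙ N) ≤ √(2 / p) * frobNorm N := by
  have h1 := (le_abs_self _).trans (h.abs_sum_le hN hN)
  rw [frobNorm, Real.sqrt_le_left (mul_nonneg (Real.sqrt_nonneg _) (frobNorm_nonneg N)), mul_pow,
    Real.sq_sqrt (by positivity)]
  have e : ∑ i, ∑ j, (N + ξ ⊙ N) i j ^ 2 =
      1 / p * (frobNorm N ^ 2 + ∑ i, ∑ j, ξ i j * (N i j * N i j)) := by
    rw [frobNorm_sq, frobInner, ← Finset.sum_add_distrib, Finset.mul_sum]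
    refine Finset.sum_congr rfl fun i _ => ?_
    rw [← Finset.sum_add_distrib, Finset.mul_sum]
    refine Finset.sum_congr rfl fun j _ => ?_
    rw [Matrix.add_apply, hadamard_apply]
    linear_combination N i j ^ 2 * hξ i j
  rw [e, show 2 / p * frobNorm N ^ 2 = 1 / p * (2 * frobNorm N ^ 2) by ring]
  gcongr
  nlinarith [sq_nonneg (frobNorm N)]

theorem sqrt_row_le_of_entry_le {W : Matrix (Fin m) (Fin n) ℝ} {t : ℝ} (ht : 0 ≤ t)
    (hW : ∀ i j, |W i j| ≤ t) (i : Fin m) : √(W i ⬝ᵥ W i) ≤ √n * t := by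
  rw [Real.sqrt_le_left (by positivity), mul_pow, Real.sq_sqrt (by positivity)]
  calc W i ⬝ᵥ W i ≤ ∑ _j : Fin n, t ^ 2 :=
        Finset.sum_le_sum fun j _ => by
          rw [← abs_mul_abs_self, ← pow_two]
          exact pow_le_pow_left₀ (abs_nonneg _) (hW i j) 2
    _ = n * t ^ 2 := by simp

theorem PTperp_hadamard_specLE (hU : Uᵀ * U = 1) (hV : Vᵀ * V = 1) {X : Matrix (Fin m) (Fin n) ℝ}
    {s : ℝ} (hX : SpecLE X s) (hs : 0 ≤ s) : SpecLE (PTperp U V X) s := by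
  refine hX.mul_mul hs (fun x => ?_) (proj_compl_mulVec_dotProduct_le hV)
  rw [transpose_sub, transpose_one, transpose_mul, transpose_transpose]
  exact proj_compl_mulVec_dotProduct_le hU x

/-- The spectral bound for the part of the dual certificate orthogonal to `T`. -/
theorem GoodPattern.specLE_PTperp {b γ t u v s p : ℝ} (hU : Uᵀ * U = 1) (hV : Vᵀ * V = 1)
    (h : GoodPattern U V ξ a b γ t) (ha0 : 0 ≤ a) (ha : a ≤ 1 / 2) (hb : 0 ≤ b) (hγ : 0 ≤ γ)
    (ht : 0 ≤ t) (hu : 0 ≤ u) (hv : 0 ≤ v) (hp : 0 < p) (hξ : ∀ i j, -1 ≤ ξ i j)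
    (hξ2 : ∀ i j, (1 + ξ i j) ^ 2 = (1 + ξ i j) / p) (hs : frobNorm (U * Vᵀ) ≤ s)
    (hUu : ∀ i, √(U i ⬝ᵥ U i) ≤ u) (hVv : ∀ j, √(V j ⬝ᵥ V j) ≤ v)
    {G : Matrix (Fin m) (Fin n) ℝ} (hG : PT U V G = G)
    (hGE : PT U V (G + ξ ⊙ G) = U * Vᵀ) :
    SpecLE (PTperp U V (G + ξ ⊙ G))
      (γ + (b * (u * (√m * t)) + b * (√n * t * v) + b * (γ * u * v)) +
        (b * (u * (v * (a ^ 2 * s) + 3 * √m * t)) + b * ((u * (a ^ 2 * s) + 3 * √n * t) * v) +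
          b * (a ^ 2 * s * u * v)) + √(2 / p) * (a ^ 3 * (2 * s))) := by
  have hs0 : 0 ≤ s := (frobNorm_nonneg _).trans hs
  set E := U * Vᵀ with hE
  have hET : PT U V E = E := PT_mul_transpose hU hV
  set k : Matrix (Fin m) (Fin n) ℝ → Matrix (Fin m) (Fin n) ℝ := fun X => PT U V (ξ ⊙ X) with hk
  have hkT : ∀ X, PT U V (k X) = k X := fun X => PT_PT hU hV _
  have hkn : ∀ {X}, PT U V X = X → frobNorm (k X) ≤ a * frobNorm X :=
    fun hX => h.restricted.frobNorm_PT_hadamard_le hU hV ha0 hX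
  have hksub : ∀ X Y, k (X - Y) = k X - k Y := fun X Y => by
    simp only [hk, hadamard_sub_right, PT_sub]
  have hG1 : G = E - k G := by
    rw [← hGE, PT_add, hG]
    simp [hk]
  have hGexp : G = E - k E + k (k E) - k (k (k G)) := by
    have h2 : k G = k E - k (k G) := by
      conv_lhs => rw [hG1]
      rw [hksub]
    have h3 : k (k G) = k (k E) - k (k (k G)) := by
      conv_lhs => rw [h2]
      rw [hksub]
    conv_lhs => rw [hG1, h2, h3]
    abel
  have hGn : frobNorm G ≤ 2 * s := by
    have h1 : frobNorm G ≤ frobNorm E + frobNorm (k G) := by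
      conv_lhs => rw [hG1, sub_eq_add_neg]
      exact (frobNorm_add_le _ _).trans (by rw [frobNorm_neg])
    nlinarith [hkn hG, frobNorm_nonneg G]
  have hWn : frobNorm (k E) ≤ a * s := (hkn hET).trans (by gcongr)
  have hZn : frobNorm (k (k E)) ≤ a ^ 2 * s := by
    refine (hkn (hkT _)).trans ?_
    rw [pow_two, mul_assoc]
    gcongr
  have hNn : frobNorm (k (k (k G))) ≤ a ^ 3 * (2 * s) := by
    calc frobNorm (k (k (k G))) ≤ a * (a * (a * frobNorm G)) :=
          (hkn (hkT _)).trans (mul_le_mul_of_nonneg_left ((hkn (hkT _)).trans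
            (mul_le_mul_of_nonneg_left (hkn hG) ha0)) ha0)
      _ = a ^ 3 * frobNorm G := by ring
      _ ≤ a ^ 3 * (2 * s) := by gcongr
  have hWt : ∀ i j, |k E i j| ≤ t := h.entry
  have b1 : SpecLE (ξ ⊙ k E) (b * (u * (√m * t)) + b * (√n * t * v) + b * (γ * u * v)) := by
    refine specLE_hadamard_of_PT_eq hU hV h.spec hb hu hv (by positivity) (by positivity) hγ hUu
      hVv (hkT E) (sqrt_row_le_of_entry_le ht hWt)
      (sqrt_row_le_of_entry_le ht fun j i => hWt i j) ?_
    simp only [hk]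
    rw [transpose_mul_PT_mul hU hV]
    refine h.specSign.mul_mul hγ (fun x => ?_) fun x => ?_
    · rw [transpose_transpose, mulVec_dotProduct_mulVec_of_isometry hU]
    · rw [mulVec_dotProduct_mulVec_of_isometry hV]
  have b2 : SpecLE (ξ ⊙ k (k E)) (b * (u * (v * (a ^ 2 * s) + 3 * √m * t)) +
      b * ((u * (a ^ 2 * s) + 3 * √n * t) * v) + b * (a ^ 2 * s * u * v)) := by
    refine specLE_hadamard_of_PT_eq hU hV h.spec hb hu hv (by positivity) (by positivity)
      (by positivity) hUu hVv (hkT _) (fun i => ?_) (fun j => ?_) ?_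
    · refine (h.restricted.sqrt_row_PT_hadamard_le hU hV (by linarith) hξ ht hUu hWt
        (h.rowSum i)).trans ?_
      gcongr
    · have := h.restricted.transpose.sqrt_row_PT_hadamard_le hV hU (by linarith)
        (fun i j => hξ j i) ht hVv (W := (k E)ᵀ) (fun j i => hWt i j) (h.colSum j)
      rw [← transpose_hadamard, ← PT_transpose, frobNorm_transpose] at this
      refine this.trans ?_
      gcongr
    · refine ((specLE_frobNorm _).mono hZn).mul_mul (by positivity) (fun x => ?_) fun x => ?_
      · rw [transpose_transpose, mulVec_dotProduct_mulVec_of_isometry hU]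
      · rw [mulVec_dotProduct_mulVec_of_isometry hV]
  have b3 : SpecLE (k (k (k G)) + ξ ⊙ k (k (k G))) (√(2 / p) * (a ^ 3 * (2 * s))) := by
    refine (specLE_frobNorm _).mono ?_
    refine (h.restricted.frobNorm_add_hadamard_le (by linarith) hp hξ2 (hkT _)).trans ?_
    gcongr
  have e : PTperp U V (G + ξ ⊙ G) = PTperp U V (ξ ⊙ E - ξ ⊙ k E + ξ ⊙ k (k E) -
      (k (k (k G)) + ξ ⊙ k (k (k G)))) := by
    have e1 : G + ξ ⊙ G = (ξ ⊙ E - ξ ⊙ k E + ξ ⊙ k (k E) -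
      (k (k (k G)) + ξ ⊙ k (k (k G)))) + PT U V (G + k (k (k G))) := by
      rw [PT_add, hG, hkT]
      nth_rewrite 2 [hGexp]
      simp only [hadamard_sub_right, hadamard_add]
      abel
    rw [e1, PTperp_add, PTperp_PT hU hV, add_zero]
  rw [e]
  exact PTperp_hadamard_specLE hU hV (((h.specSign.sub b1).add b2).sub b3) (by positivity)

/-- Invertibility of the sampled operator on `T`. -/
theorem RestrictedLE.bijOn (hU : Uᵀ * U = 1) (hV : Vᵀ * V = 1) (h : RestrictedLE U V ξ a)
    (ha0 : 0 ≤ a) (ha : a < 1) {p : ℝ} (hp : 0 < p) :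
    Set.BijOn (fun X => PT U V (p • (PT U V X + ξ ⊙ PT U V X)))
      {M | memT U V M} {M | memT U V M} := by
  let L : Matrix (Fin m) (Fin n) ℝ →ₗ[ℝ] Matrix (Fin m) (Fin n) ℝ :=
    { toFun := fun X => PT U V (p • (PT U V X + ξ ⊙ PT U V X))
      map_add' := fun X Y => by
        simp only [PT_add, hadamard_add, smul_add]
        abel
      map_smul' := fun c X => by
        simp only [PT_add, PT_smul, hadamard_smul, smul_add, RingHom.id_apply]
        simp only [smul_comm c p] }
  let T : Submodule ℝ (Matrix (Fin m) (Fin n) ℝ) :=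
    { carrier := {M | memT U V M}
      add_mem' := fun {X Y} hX hY => by
        simp only [Set.mem_ofPred_eq, memT_iff hU hV, PT_add] at *
        rw [hX, hY]
      zero_mem' := ⟨0, 0, by simp⟩
      smul_mem' := fun c X hX => by
        simp only [Set.mem_ofPred_eq, memT_iff hU hV, PT_smul] at *
        rw [hX] }
  have hLT : ∀ X ∈ T, L X ∈ T := fun X _ => (memT_iff hU hV _).2 (PT_PT hU hV _)
  have hinj : Function.Injective (L.restrict hLT) := by
    rw [← LinearMap.ker_eq_bot, LinearMap.ker_eq_bot']
    rintro ⟨X, hX⟩ hX0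
    have hXT : PT U V X = X := (memT_iff hU hV X).1 hX
    have h0 : PT U V (p • (PT U V X + ξ ⊙ PT U V X)) = 0 := congrArg Subtype.val hX0
    rw [PT_smul, hXT, PT_add, hXT, smul_eq_zero_iff_right hp.ne'] at h0
    have h1 : frobNorm X = frobNorm (PT U V (ξ ⊙ X)) := by
      rw [eq_neg_of_add_eq_zero_left h0, frobNorm_neg]
      rw [← eq_neg_of_add_eq_zero_left h0]
    have h2 := h.frobNorm_PT_hadamard_le hU hV ha0 hXT
    have h3 : frobNorm X = 0 := by nlinarith [frobNorm_nonneg X]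
    exact Subtype.ext (eq_zero_of_frobNorm_eq_zero h3)
  have hsurj := LinearMap.injective_iff_surjective.1 hinj
  refine ⟨hLT, fun X hX Y hY hXY => ?_, fun Y hY => ?_⟩
  · exact congrArg Subtype.val (@hinj ⟨X, hX⟩ ⟨Y, hY⟩ (Subtype.ext hXY))
  · obtain ⟨X, hX⟩ := hsurj ⟨Y, hY⟩
    exact ⟨X, X.2, congrArg Subtype.val hX⟩

end Deterministic

/-! ### Probability of a good sampling pattern -/

section Pattern

variable {m n r : ℕ}

/-- The centred and rescaled sampling pattern. -/
noncomputable def samplePattern (p : ℝ) (Ω : Finset (Fin m × Fin n)) : Matrix (Fin m) (Fin n) ℝ :=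
  of fun i j => berDev p Ω (i, j)

theorem samplePattern_apply (p : ℝ) (Ω : Finset (Fin m × Fin n)) (i : Fin m) (j : Fin n) :
    samplePattern p Ω i j = berDev p Ω (i, j) := rfl

theorem frobInner_single (i : Fin m) (j : Fin n) (X : Matrix (Fin m) (Fin n) ℝ) :
    frobInner (single i j 1) X = X i j := by
  rw [frobInner, Finset.sum_eq_single i, Finset.sum_eq_single j]
  · simp
  · intro b _ hb
    simp [single, hb.symm]
  · simp
  · intro b _ hb
    simp [single, hb.symm]
  · simp

section Incoherent

variable {U : Matrix (Fin m) (Fin r) ℝ} {V : Matrix (Fin n) (Fin r) ℝ}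

theorem frobInner_PT_single (i : Fin m) (j : Fin n) (X : Matrix (Fin m) (Fin n) ℝ) :
    frobInner (PT U V (single i j 1)) X = PT U V X i j := by
  rw [frobInner_PT, frobInner_single]

theorem mul_transpose_self_apply (i : Fin m) : (U * Uᵀ) i i = ∑ k, U i k ^ 2 := by
  simp only [mul_apply, transpose_apply, pow_two]

theorem PT_single_self (i : Fin m) (j : Fin n) :
    PT U V (single i j 1) i j =
      (U * Uᵀ) i i + (V * Vᵀ) j j - (U * Uᵀ) i i * (V * Vᵀ) j j := by
  simp only [PT, Matrix.sub_apply, Matrix.add_apply]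
  generalize U * Uᵀ = A
  generalize V * Vᵀ = B
  have e1 : (A * single i j (1 : ℝ)) i j = A i i := by simp
  have e2 : (single i j (1 : ℝ) * B) i j = B j j := by simp
  have e3 : (A * single i j (1 : ℝ) * B) i j = A i i * B j j := by
    rw [mul_apply, Finset.sum_eq_single j]
    · rw [e1]
    · intro b _ hb
      rw [mul_single_apply_of_ne _ _ _ _ _ hb, zero_mul]
    · simp
  rw [e1, e2, e3]

variable {ρ : ℝ}

theorem PT_single_self_le (hρ : ∀ i j, ∑ k, U i k ^ 2 + ∑ k, V j k ^ 2 ≤ ρ)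
    (i : Fin m) (j : Fin n) : PT U V (single i j 1) i j ≤ ρ := by
  rw [PT_single_self, mul_transpose_self_apply, mul_transpose_self_apply]
  have h1 : 0 ≤ ∑ k, U i k ^ 2 := Finset.sum_nonneg fun _ _ => sq_nonneg _
  have h2 : 0 ≤ ∑ k, V j k ^ 2 := Finset.sum_nonneg fun _ _ => sq_nonneg _
  nlinarith [hρ i j, mul_nonneg h1 h2]

theorem frobInner_PT_single_self_le (hU : Uᵀ * U = 1) (hV : Vᵀ * V = 1)
    (hρ : ∀ i j, ∑ k, U i k ^ 2 + ∑ k, V j k ^ 2 ≤ ρ)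
    (i : Fin m) (j : Fin n) :
    frobInner (PT U V (single i j 1)) (PT U V (single i j 1)) ≤ ρ := by
  rw [frobInner_PT_single, PT_PT hU hV]
  exact PT_single_self_le hρ i j

theorem abs_PT_single_le (hU : Uᵀ * U = 1) (hV : Vᵀ * V = 1)
    (hρ : ∀ i j, ∑ k, U i k ^ 2 + ∑ k, V j k ^ 2 ≤ ρ)
    (i k : Fin m) (j l : Fin n) : |PT U V (single i j 1) k l| ≤ ρ := by
  have h0 : 0 ≤ ρ := (frobInner_self_nonneg _).trans (frobInner_PT_single_self_le hU hV hρ i j)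
  rw [← PT_PT hU hV, ← frobInner_PT_single]
  refine (abs_frobInner_le _ _).trans ?_
  rw [frobNorm_eq, frobNorm_eq]
  calc _ ≤ √ρ * √ρ := mul_le_mul (Real.sqrt_le_sqrt (frobInner_PT_single_self_le hU hV hρ k l))
        (Real.sqrt_le_sqrt (frobInner_PT_single_self_le hU hV hρ i j)) (Real.sqrt_nonneg _)
        (Real.sqrt_nonneg _)
    _ = ρ := Real.mul_self_sqrt h0

theorem berPr_not_restrictedLE_le (hU : Uᵀ * U = 1) (hV : Vᵀ * V = 1)
    (hρ : ∀ i j, ∑ k, U i k ^ 2 + ∑ k, V j k ^ 2 ≤ ρ)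
    {p : ℝ} (h0 : 0 < p) (h1 : p ≤ 1) (hρ0 : 0 < ρ) {q : ℕ}
    (hq : q ≠ 0) (hqρ : q * ρ / p ≤ 1) {a : ℝ} (ha0 : 0 ≤ a) (ha : 40 * (q * ρ / p) ≤ a ^ 2) :
    berPr p (fun Ω : Finset (Fin m × Fin n) => ¬ RestrictedLE U V (samplePattern p Ω) a) ≤
      (m * n : ℕ) * Real.exp (-(2 * q)) := by
  have hdot : ∀ (x : Fin m × Fin n) (X : Matrix (Fin m) (Fin n) ℝ),
      (fun y : Fin m × Fin n => PT U V (single x.1 x.2 1) y.1 y.2) ⬝ᵥ (fun y => X y.1 y.2) =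
        PT U V X x.1 x.2 := fun x X => by
    rw [← frobInner_eq_dotProduct, frobInner_PT_single]
  have key := berPr_berSum_le h0 h1
    (fun (x y : Fin m × Fin n) => PT U V (single x.1 x.2 1) y.1 y.2) (R := ρ) (B := 1)
    (fun x => by
      rw [← frobInner_eq_dotProduct]
      exact frobInner_PT_single_self_le hU hV hρ x.1 x.2)
    (fun z => by
      have hz : z = fun y => (of fun i j => z (i, j) : Matrix (Fin m) (Fin n) ℝ) y.1 y.2 := rfl
      rw [hz]
      simp only [hdot]
      rw [one_mul, ← frobInner_eq_dotProduct, ← frobNorm_sq]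
      refine le_trans (le_of_eq ?_)
        (pow_le_pow_left₀ (frobNorm_nonneg _) (frobNorm_PT_le hU hV _) 2)
      rw [frobNorm_sq, frobInner, Fintype.sum_prod_type]
      simp only [pow_two])
    hρ0 one_pos hq hqρ ha0 (by rwa [mul_one])
  rw [Fintype.card_prod, Fintype.card_fin, Fintype.card_fin] at key
  refine (berPr_mono h0.le h1 fun Ω hΩ hall => hΩ fun X Y => ?_).trans key
  have h2 := hall (fun y => X y.1 y.2) (fun y => Y y.1 y.2)
  simp only [hdot] at h2
  rw [← frobInner_eq_dotProduct, ← frobInner_eq_dotProduct, ← frobNorm_eq, ← frobNorm_eq,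
    Fintype.sum_prod_type] at h2
  exact h2

theorem berPr_PT_entry_le (hU : Uᵀ * U = 1) (hV : Vᵀ * V = 1)
    (hρ : ∀ i j, ∑ k, U i k ^ 2 + ∑ k, V j k ^ 2 ≤ ρ)
    {p : ℝ} (h0 : 0 < p) (h1 : p ≤ 1) (hρ0 : 0 < ρ) {e : ℝ} (he : 0 < e)
    {E : Matrix (Fin m) (Fin n) ℝ} (hE : ∀ i j, |E i j| ≤ e) {s : ℝ} (hs : 0 < s)
    (hsρ : s * ρ ≤ p) {t : ℝ} (ht : 0 ≤ t) (hst : 4 * (s * (e ^ 2 * ρ) / p) ≤ t ^ 2) :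
    berPr p (fun Ω : Finset (Fin m × Fin n) =>
      ∃ x : Fin m × Fin n, ¬ |PT U V (samplePattern p Ω ⊙ E) x.1 x.2| ≤ t) ≤
      (m * n : ℕ) * (2 * Real.exp (-s)) := by
  refine (berPr_exists_le h0.le h1 _ (b := 2 * Real.exp (-s)) fun x => ?_).trans (by simp)
  set P := PT U V (single x.1 x.2 1) with hP
  have key := berExp_abs_sum_berDev_gt_le h0 h1 (fun y : Fin m × Fin n => E y.1 y.2 * P y.1 y.2)
    (v := e ^ 2 * ρ) (R := e * ρ) (s := s)
    (by
      calc ∑ y : Fin m × Fin n, (E y.1 y.2 * P y.1 y.2) ^ 2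
          ≤ ∑ y : Fin m × Fin n, e ^ 2 * (P y.1 y.2 * P y.1 y.2) := by
            refine Finset.sum_le_sum fun y _ => ?_
            rw [mul_pow, ← sq_abs (E y.1 y.2), pow_two (P y.1 y.2)]
            exact mul_le_mul_of_nonneg_right
              (pow_le_pow_left₀ (abs_nonneg _) (hE _ _) 2) (mul_self_nonneg _)
        _ = e ^ 2 * frobInner P P := by
            rw [← Finset.mul_sum, Fintype.sum_prod_type]
            rfl
        _ ≤ e ^ 2 * ρ := by
            gcongr
            exact frobInner_PT_single_self_le hU hV hρ _ _)
    (fun y => by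
      rw [abs_mul]
      exact mul_le_mul (hE _ _) (abs_PT_single_le hU hV hρ _ _ _ _) (abs_nonneg _) he.le)
    (by positivity) hs (by
      have := mul_le_mul_of_nonneg_left hsρ (show 0 ≤ e ^ 2 * ρ by positivity)
      linarith)
  refine (berPr_mono h0.le h1 fun Ω hΩ => ?_).trans key
  rw [not_le] at hΩ
  have e1 : PT U V (samplePattern p Ω ⊙ E) x.1 x.2 =
      ∑ y : Fin m × Fin n, berDev p Ω y * (E y.1 y.2 * P y.1 y.2) := by
    rw [← frobInner_PT_single, frobInner, Fintype.sum_prod_type]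
    refine Finset.sum_congr rfl fun i _ => Finset.sum_congr rfl fun j _ => ?_
    rw [hadamard_apply, samplePattern_apply]
    ring
  rw [e1] at hΩ
  refine lt_of_le_of_lt ?_ hΩ
  rw [show (2 : ℝ) = √4 by rw [show (4 : ℝ) = 2 ^ 2 by norm_num]; simp,
    ← Real.sqrt_mul (by norm_num)]
  exact (Real.sqrt_le_left ht).2 hst

end Incoherent

theorem berPr_not_specLE_hadamard_le {p : ℝ} (h0 : 0 < p) (h1 : p ≤ 1)
    {w : Matrix (Fin m) (Fin n) ℝ} {ω N : ℝ} (hω : 0 < ω) (hw0 : ∀ i j, 0 ≤ w i j)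
    (hw : ∀ i j, w i j ≤ ω) (hN : 0 < N) (hmN : (m : ℝ) ≤ N) (hnN : (n : ℝ) ≤ N) {q : ℕ}
    (hq : q ≠ 0) (hqN : q ≤ p * N) {t : ℝ} (ht : 0 ≤ t)
    (hqt : 160 * (ω ^ 2 * (q * N / p)) ≤ t ^ 2) :
    berPr p (fun Ω : Finset (Fin m × Fin n) => ¬ SpecLE (samplePattern p Ω ⊙ w) t) ≤
      (m + n : ℕ) * Real.exp (-(2 * q)) := by
  have hdot : ∀ (x : Fin m × Fin n) (z : Fin m ⊕ Fin n → ℝ),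
      (√(w x.1 x.2) • Sum.elim (Pi.single x.1 (1 : ℝ)) (Pi.single x.2 (1 : ℝ))) ⬝ᵥ z =
        √(w x.1 x.2) * (z (Sum.inl x.1) + z (Sum.inr x.2)) := fun x z => by
    rw [smul_dotProduct, smul_eq_mul]
    congr 1
    simp only [dotProduct, Fintype.sum_sum_type, Sum.elim_inl, Sum.elim_inr]
    simp [Pi.single_apply]
  have key := berPr_berSum_le h0 h1
    (fun x : Fin m × Fin n => √(w x.1 x.2) •
      Sum.elim (Pi.single x.1 (1 : ℝ)) (Pi.single x.2 (1 : ℝ))) (R := 2 * ω) (B := 2 * (N * ω))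
    (fun x => by
      rw [hdot]
      simp only [Pi.smul_apply, Sum.elim_inl, Sum.elim_inr, Pi.single_eq_same, smul_eq_mul]
      have := Real.mul_self_sqrt (hw0 x.1 x.2)
      nlinarith [hw x.1 x.2])
    (fun z => by
      simp only [hdot, mul_pow, Real.sq_sqrt (hw0 _ _)]
      calc ∑ x : Fin m × Fin n, w x.1 x.2 * (z (Sum.inl x.1) + z (Sum.inr x.2)) ^ 2
          ≤ ∑ x : Fin m × Fin n, 2 * ω * (z (Sum.inl x.1) ^ 2 + z (Sum.inr x.2) ^ 2) := by
            refine Finset.sum_le_sum fun x _ => ?_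
            have g1 := mul_le_mul_of_nonneg_right (hw x.1 x.2)
              (sq_nonneg (z (Sum.inl x.1) + z (Sum.inr x.2)))
            nlinarith [mul_nonneg hω.le (sq_nonneg (z (Sum.inl x.1) - z (Sum.inr x.2)))]
        _ = 2 * ω * (n * ∑ i, z (Sum.inl i) ^ 2 + m * ∑ j, z (Sum.inr j) ^ 2) := by
            rw [← Finset.mul_sum, Finset.sum_add_distrib, Fintype.sum_prod_type,
              Fintype.sum_prod_type]
            simp [Finset.mul_sum]
        _ ≤ 2 * ω * (N * ∑ i, z (Sum.inl i) ^ 2 + N * ∑ j, z (Sum.inr j) ^ 2) := by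
            have : ∀ {k : ℕ} (f : Fin k → ℝ), 0 ≤ ∑ i, f i ^ 2 := fun f =>
              Finset.sum_nonneg fun _ _ => sq_nonneg _
            have g1 := this fun i => z (Sum.inl i)
            have g2 := this fun i => z (Sum.inr i)
            gcongr
        _ = 2 * (N * ω) * (z ⬝ᵥ z) := by
            simp only [dotProduct, Fintype.sum_sum_type, pow_two]
            ring)
    (by positivity) (by positivity) hq
    (by
      rw [div_le_iff₀ h0]
      nlinarith [mul_le_mul_of_nonneg_right hqN hω.le])
    ht (by
      refine le_trans (le_of_eq ?_) hqt
      ring)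
  rw [Fintype.card_sum, Fintype.card_fin, Fintype.card_fin] at key
  refine (berPr_mono h0.le h1 fun Ω hΩ hall => hΩ fun x y => ?_).trans key
  have h2 := hall (Sum.elim x 0) (Sum.elim 0 y)
  simp only [hdot] at h2
  have ex : Sum.elim x (0 : Fin n → ℝ) ⬝ᵥ Sum.elim x 0 = x ⬝ᵥ x := by simp
  have ey : Sum.elim (0 : Fin m → ℝ) y ⬝ᵥ Sum.elim 0 y = y ⬝ᵥ y := by simp
  rw [ex, ey] at h2
  refine le_trans (le_of_eq ?_) h2
  congr 1
  rw [dotProduct_mulVec_eq_frobInner, frobInner, Fintype.sum_prod_type]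
  refine Finset.sum_congr rfl fun i _ => Finset.sum_congr rfl fun j _ => ?_
  simp only [Sum.elim_inl, Sum.elim_inr, Pi.zero_apply, hadamard_apply, samplePattern_apply,
    vecMulVec_apply]
  have := Real.mul_self_sqrt (hw0 i j)
  linear_combination -(berDev p Ω (i, j) * x i * y j) * this

theorem berPr_sum_indicator_gt_le {ι : Type*} [Fintype ι] {p : ℝ} (h0 : 0 < p) (h1 : p ≤ 1)
    (S : Finset ι) {k s : ℝ} (hS : (S.card : ℝ) = k) (hk : 0 < k) (hs : 0 < s)
    (hsk : 4 * s ≤ p * k) :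
    berPr p (fun Ω : Finset ι => ¬ ∑ i ∈ S, berDev p Ω i ≤ k) ≤ 2 * Real.exp (-s) := by
  have key := berExp_abs_sum_berDev_gt_le h0 h1 (fun i : ι => if i ∈ S then (1 : ℝ) else 0)
    (v := k) (R := 1) (s := s) (by simp [hS]) (fun i => by split_ifs <;> simp) hk hs (by linarith)
  refine (berPr_mono h0.le h1 fun Ω hΩ => ?_).trans key
  rw [not_le] at hΩ
  have e : ∑ i, berDev p Ω i * (if i ∈ S then (1 : ℝ) else 0) = ∑ i ∈ S, berDev p Ω i := by
    simp
  rw [e]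
  refine lt_of_le_of_lt ?_ (hΩ.trans_le (le_abs_self _))
  rw [show (2 : ℝ) = √4 by rw [show (4 : ℝ) = 2 ^ 2 by norm_num]; simp,
    ← Real.sqrt_mul (by norm_num), Real.sqrt_le_left hk.le, mul_div_assoc', div_le_iff₀ h0]
  nlinarith

end Pattern

section Assembly

variable {m n r : ℕ} {U : Matrix (Fin m) (Fin r) ℝ} {V : Matrix (Fin n) (Fin r) ℝ}

theorem berPr_not_specLE_hadamard_of_abs_le {p : ℝ} (h0 : 0 < p) (h1 : p ≤ 1)
    {E : Matrix (Fin m) (Fin n) ℝ} {e : ℝ} (he : 0 < e) (hE : ∀ i j, |E i j| ≤ e) {N : ℝ}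
    (hN : 0 < N) (hmN : (m : ℝ) ≤ N) (hnN : (n : ℝ) ≤ N) {q : ℕ} (hq : q ≠ 0) (hqN : q ≤ p * N)
    {t : ℝ} (ht : 0 ≤ t) (htq : 160 * (e ^ 2 * (q * N / p)) ≤ t ^ 2) :
    berPr p (fun Ω => ¬ SpecLE (samplePattern p Ω ⊙ E) (2 * t)) ≤
      2 * ((m + n) * Real.exp (-(2 * q))) := by
  have hpos := berPr_not_specLE_hadamard_le h0 h1 (w := of fun i j => max (E i j) 0) he
    (fun i j => le_max_right (E i j) 0)
    (fun i j => max_le ((le_abs_self _).trans (hE i j)) he.le) hN hmN hnN hq hqN ht htq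
  have hneg := berPr_not_specLE_hadamard_le h0 h1 (w := of fun i j => max (-E i j) 0) he
    (fun i j => le_max_right (-E i j) 0)
    (fun i j => max_le ((neg_le_abs _).trans (hE i j)) he.le) hN hmN hnN hq hqN ht htq
  have hor := (berPr_or_le h0.le h1 _ _).trans (add_le_add hpos hneg)
  push_cast at hor
  refine (berPr_mono h0.le h1 fun Ω hΩ => ?_).trans (hor.trans (two_mul _).ge)
  by_contra hcon
  rw [not_or, not_not, not_not] at hcon
  refine hΩ ?_
  have := hcon.1.sub hcon.2
  rw [← hadamard_sub_right, ← two_mul] at this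
  convert this using 2
  ext i j
  simp only [Matrix.sub_apply, of_apply]
  exact (max_zero_sub_max_neg_zero_eq_self _).symm

set_option maxHeartbeats 1000000 in
theorem berPr_not_goodPattern_le (hU : Uᵀ * U = 1) (hV : Vᵀ * V = 1) {ν : ℝ} (hν : 1 ≤ ν)
    (hUν : ∀ i, ∑ k, U i k ^ 2 ≤ ν / m) (hVν : ∀ j, ∑ k, V j k ^ 2 ≤ ν / n)
    (hUVν : ∀ i j, |(U * Vᵀ) i j| ≤ √(ν / (m * n))) {p : ℝ} (h0 : 0 < p) (h1 : p ≤ 1)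
    (hm : 0 < m) (hn : 0 < n) {N : ℝ} (hmN : (m : ℝ) ≤ N) (hnN : (n : ℝ) ≤ N) (hN2 : 2 ≤ N)
    {q : ℕ} (hq : q ≠ 0) {τ : ℝ} (hτ0 : 0 ≤ τ) (hτ : τ ^ 2 * (p * (m * n)) = q * N)
    (hντ : ν * τ ^ 2 ≤ 1 / 100) :
    berPr p (fun Ω : Finset (Fin m × Fin n) => ¬ GoodPattern U V (samplePattern p Ω)
      (9 * (√ν * τ)) (13 * τ * √(m * n)) (26 * (√ν * τ)) (4 * (√ν * τ) * √(ν / (m * n)))) ≤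
      8 * (N ^ 2 * Real.exp (-(2 * q))) := by
  have hm' : (0 : ℝ) < m := by exact_mod_cast hm
  have hn' : (0 : ℝ) < n := by exact_mod_cast hn
  have hq' : (0 : ℝ) < q := by exact_mod_cast Nat.pos_of_ne_zero hq
  have hN : 0 < N := by linarith
  have hν0 : 0 < ν := by linarith
  have hD : (0 : ℝ) < m * n := by positivity
  set D : ℝ := m * n with hDdef
  set e : ℝ := √(ν / D) with hedef
  have he : 0 < e := Real.sqrt_pos.2 (by positivity)
  have he2 : e ^ 2 = ν / D := Real.sq_sqrt (by positivity)
  have hα2 : (√ν * τ) ^ 2 = ν * τ ^ 2 := by rw [mul_pow, Real.sq_sqrt hν0.le]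
  have hα0 : 0 ≤ √ν * τ := by positivity
  set α := √ν * τ with hα
  have hτ2 : τ ^ 2 ≤ 1 / 100 := by nlinarith [sq_nonneg τ]
  have hqN : q * N / p = τ ^ 2 * D := by
    rw [div_eq_iff h0.ne']
    linarith
  set ρ : ℝ := 2 * ν * N / D with hρdef
  have hρ0 : 0 < ρ := by positivity
  have hqρ : q * ρ / p = 2 * (ν * τ ^ 2) := by
    have : q * ρ / p = 2 * ν / D * (q * N / p) := by
      rw [hρdef]
      ring
    rw [this, hqN]
    field_simp
  have hρ : ∀ i j, ∑ k, U i k ^ 2 + ∑ k, V j k ^ 2 ≤ ρ := fun i j => by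
    have g1 : ν / m ≤ ν * N / D := by
      rw [hDdef, div_le_div_iff₀ hm' (by positivity)]
      nlinarith [mul_le_mul_of_nonneg_left hnN (show 0 ≤ ν * m by positivity)]
    have g2 : ν / n ≤ ν * N / D := by
      rw [hDdef, div_le_div_iff₀ hn' (by positivity)]
      nlinarith [mul_le_mul_of_nonneg_left hmN (show 0 ≤ ν * n by positivity)]
    have g3 : ρ = ν * N / D + ν * N / D := by
      rw [hρdef]
      ring
    linarith [hUν i, hVν j]
  have hqm : 100 * q ≤ p * m := by
    have : (q : ℝ) * N ≤ 1 / 100 * (p * m) * N := by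
      rw [← hτ]
      calc τ ^ 2 * (p * D) ≤ 1 / 100 * (p * D) := by gcongr
        _ = 1 / 100 * (p * m) * n := by
            rw [hDdef]
            ring
        _ ≤ 1 / 100 * (p * m) * N := by gcongr
    linarith [le_of_mul_le_mul_right this hN]
  have hqn : 100 * q ≤ p * n := by
    have : (q : ℝ) * N ≤ 1 / 100 * (p * n) * N := by
      rw [← hτ]
      calc τ ^ 2 * (p * D) ≤ 1 / 100 * (p * D) := by gcongr
        _ = 1 / 100 * (p * n) * m := by
            rw [hDdef]
            ring
        _ ≤ 1 / 100 * (p * n) * N := by gcongr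
    linarith [le_of_mul_le_mul_right this hN]
  have hqpN : q ≤ p * N := by nlinarith
  have hexp := Real.exp_pos (-(2 * (q : ℝ)))
  have evA := berPr_not_restrictedLE_le hU hV hρ h0 h1 hρ0 hq (by rw [hqρ]; linarith)
    (a := 9 * α) (by positivity) (by rw [hqρ, mul_pow, hα2]; nlinarith [sq_nonneg τ])
  have evB := berPr_not_specLE_hadamard_le (m := m) (n := n) h0 h1 (w := of fun _ _ => 1) (ω := 1)
    one_pos (fun _ _ => zero_le_one) (fun _ _ => le_rfl) hN hmN hnN hq hqpN
    (t := 13 * τ * √D) (by positivity) (by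
      rw [hqN, mul_pow, mul_pow, Real.sq_sqrt hD.le]
      nlinarith [mul_nonneg (sq_nonneg τ) hD.le])
  have hCt : 160 * (e ^ 2 * (q * N / p)) ≤ (13 * α) ^ 2 := by
    rw [hqN, he2, mul_pow, hα2]
    have : ν / D * (τ ^ 2 * D) = ν * τ ^ 2 := by field_simp
    rw [this]
    nlinarith [mul_nonneg hν0.le (sq_nonneg τ)]
  have evC := berPr_not_specLE_hadamard_of_abs_le h0 h1 he hUVν hN hmN hnN hq hqpN
    (t := 13 * α) (by positivity) hCt
  have evD := berPr_PT_entry_le hU hV hρ h0 h1 hρ0 he hUVν (s := 2 * q) (by positivity)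
    (by
      rw [div_eq_iff h0.ne'] at hqρ
      nlinarith)
    (t := 4 * α * e) (by positivity) (by
      have : 4 * (2 * q * (e ^ 2 * ρ) / p) = 8 * e ^ 2 * (q * ρ / p) := by ring
      rw [this, hqρ, mul_pow, mul_pow, hα2]
      linarith)
  have evE := berPr_exists_le h0.le h1
    (fun (i : Fin m) (Ω : Finset (Fin m × Fin n)) =>
      ¬ ∑ x ∈ ({i} : Finset (Fin m)) ×ˢ (Finset.univ : Finset (Fin n)), berDev p Ω x ≤ n)
    (fun i => berPr_sum_indicator_gt_le h0 h1 _ (by simp) hn' (s := 2 * q) (by positivity)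
      (by linarith))
  have evE' := berPr_exists_le h0.le h1
    (fun (j : Fin n) (Ω : Finset (Fin m × Fin n)) =>
      ¬ ∑ x ∈ (Finset.univ : Finset (Fin m)) ×ˢ ({j} : Finset (Fin n)), berDev p Ω x ≤ m)
    (fun i => berPr_sum_indicator_gt_le h0 h1 _ (by simp) hm' (s := 2 * q) (by positivity)
      (by linarith))
  have hor := (berPr_or_le h0.le h1 _ _).trans (add_le_add evA
    ((berPr_or_le h0.le h1 _ _).trans (add_le_add evB
    ((berPr_or_le h0.le h1 _ _).trans (add_le_add evC
    ((berPr_or_le h0.le h1 _ _).trans (add_le_add evD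
    ((berPr_or_le h0.le h1 _ _).trans (add_le_add evE evE')))))))))
  refine (berPr_mono h0.le h1 fun Ω hΩ => ?_).trans (hor.trans ?_)
  · by_contra hcon
    rw [not_or, not_or, not_or, not_or, not_or] at hcon
    obtain ⟨hA, hB, hC, hDD, hE, hE'⟩ := hcon
    rw [not_not] at hA hB hC
    simp only [not_exists, not_not] at hDD hE hE'
    refine hΩ ⟨hA, ?_, ?_, fun i j => hDD (i, j), fun i => ?_, fun j => ?_⟩
    · convert hB using 1
      ext i j
      simp
    · rw [← mul_assoc] at hC
      norm_num at hC
      exact hC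
    · have := hE i
      rwa [Finset.sum_product, Finset.sum_singleton] at this
    · have := hE' j
      rw [Finset.sum_product] at this
      simpa [samplePattern_apply] using this
  push_cast
  rw [Fintype.card_fin, Fintype.card_fin]
  have hDN : D ≤ N ^ 2 := by
    rw [hDdef, pow_two]
    gcongr
  have hmN2 : (m : ℝ) + n ≤ N ^ 2 := by nlinarith
  have : 3 * D + 5 * (m + n) ≤ 8 * N ^ 2 := by linarith
  have := mul_le_mul_of_nonneg_right this hexp.le
  rw [← hDdef]
  linarith

theorem PΩ_eq_smul {p : ℝ} (hp : p ≠ 0) (Ω : Finset (Fin m × Fin n))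
    (X : Matrix (Fin m) (Fin n) ℝ) : PΩ Ω X = p • (X + samplePattern p Ω ⊙ X) := by
  ext i j
  simp only [PΩ, Matrix.smul_apply, Matrix.add_apply, hadamard_apply, samplePattern_apply, berDev,
    smul_eq_mul]
  split_ifs
  · field_simp
    ring
  · ring

theorem one_add_berDev_sq {ι : Type*} (p : ℝ) (Ω : Finset ι) (i : ι) :
    (1 + berDev p Ω i) ^ 2 = (1 + berDev p Ω i) / p := by
  unfold berDev
  split_ifs
  · ring
  · simp

theorem frobNorm_mul_transpose_le (hU : Uᵀ * U = 1) (hV : Vᵀ * V = 1) :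
    frobNorm (U * Vᵀ) ≤ √r := by
  rw [frobNorm_eq, frobInner_eq_trace, transpose_mul, transpose_transpose, Matrix.mul_assoc,
    ← Matrix.mul_assoc Vᵀ, hV, Matrix.one_mul, trace_mul_comm, hU, trace_one, Fintype.card_fin]

/-- The numerical value of the bound in `GoodPattern.specLE_PTperp`. -/
theorem certificate_bound_lt_one {α x s a b γ t u v um vn T : ℝ} (hα : 0 ≤ α)
    (ha : a = 9 * α) (hγ : γ = 26 * α) (hbt : b * t = 52 * α ^ 2) (hbuv : b * u * v = 13 * α * x)
    (hum : u * um = x) (hvn : vn * v = x) (hα2 : α ^ 2 ≤ 1 / 10 ^ 4)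
    (hαx : α ^ 2 * x ≤ 1 / 10 ^ 4) (hαxs : α ^ 3 * x * s ≤ 1 / 10 ^ 4) (hT : T ≤ 1 / 10) :
    γ + (b * (u * (um * t)) + b * (vn * t * v) + b * (γ * u * v)) +
      (b * (u * (v * (a ^ 2 * s) + 3 * um * t)) + b * ((u * (a ^ 2 * s) + 3 * vn * t) * v) +
        b * (a ^ 2 * s * u * v)) + T < 1 := by
  have e : γ + (b * (u * (um * t)) + b * (vn * t * v) + b * (γ * u * v)) +
      (b * (u * (v * (a ^ 2 * s) + 3 * um * t)) + b * ((u * (a ^ 2 * s) + 3 * vn * t) * v) +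
        b * (a ^ 2 * s * u * v)) + T =
      26 * α + 754 * (α ^ 2 * x) + 3159 * (α ^ 3 * x * s) + T := by
    rw [ha, hγ]
    linear_combination (4 * (u * um) + 4 * (vn * v)) * hbt +
      (26 * α + 3 * ((9 * α) ^ 2 * s)) * hbuv + 4 * (52 * α ^ 2) * hum + 4 * (52 * α ^ 2) * hvn
  rw [e]
  have : α ≤ 1 / 100 := by nlinarith
  linarith

end Assembly

section Conclusion

theorem berProb_eq_berPr (m n : ℕ) (p : ℝ) (E : Finset (Fin m × Fin n) → Prop) :
    berProb m n p E = berPr p E := by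
  unfold berProb berPr berExp berWeight
  refine Finset.sum_congr rfl fun Ω _ => ?_
  rw [Fintype.card_prod, Fintype.card_fin, Fintype.card_fin]
  ring

theorem certificate_scalar_bounds {μ r N τ : ℝ} (hμ : 1 ≤ μ) (hr : 1 ≤ r) (hN : 1 ≤ N)
    (hτ0 : 0 ≤ τ)
    (h : max (μ ^ 2) (max (μ ^ ((4 : ℝ) / 3) * r) (μ * N ^ ((1 : ℝ) / 4))) * r * τ ^ 2 ≤
      1 / 10 ^ 4) :
    (√(μ * r) * τ) ^ 2 ≤ 1 / 10 ^ 4 ∧ (√(μ * r) * τ) ^ 2 * √(μ * r) ≤ 1 / 10 ^ 4 ∧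
      (√(μ * r) * τ) ^ 3 * √(μ * r) * √r ≤ 1 / 10 ^ 4 ∧
      (√(μ * r) * τ) ^ 4 * √N ≤ 1 / 10 ^ 8 := by
  obtain ⟨w, hw1, hw3, hw4⟩ : ∃ w : ℝ, 1 ≤ w ∧ w ^ 3 = μ ∧ w ^ 4 = μ ^ ((4 : ℝ) / 3) := by
    have hμ0 : (0 : ℝ) ≤ μ := by linarith
    refine ⟨μ ^ ((1 : ℝ) / 3), Real.one_le_rpow hμ (by norm_num), ?_, ?_⟩
    · rw [← Real.rpow_natCast, ← Real.rpow_mul hμ0]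
      norm_num
    · rw [← Real.rpow_natCast, ← Real.rpow_mul hμ0]
      norm_num
  obtain ⟨z, hz1, hz4, hzN⟩ : ∃ z : ℝ, 1 ≤ z ∧ z ^ 4 = N ∧ z = N ^ ((1 : ℝ) / 4) := by
    refine ⟨_, Real.one_le_rpow hN (by norm_num), ?_, rfl⟩
    rw [← Real.rpow_natCast, ← Real.rpow_mul (by linarith)]
    norm_num
  have hzsq : √N = z ^ 2 := by
    rw [← hz4, show z ^ 4 = (z ^ 2) ^ 2 by ring, Real.sqrt_sq (by positivity)]
  have hrτ : 0 ≤ r * τ ^ 2 := by positivity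
  rw [← hw4, ← hzN, mul_assoc] at h
  set M := max (μ ^ 2) (max (w ^ 4 * r) (μ * z))
  have hx0 : 0 ≤ √(μ * r) := Real.sqrt_nonneg _
  have hx2 : √(μ * r) ^ 2 = μ * r := Real.sq_sqrt (by positivity)
  have hs0 : 0 ≤ √r := Real.sqrt_nonneg _
  have hs2 : √r ^ 2 = r := Real.sq_sqrt (by linarith)
  set x := √(μ * r)
  set s := √r
  have hα0 : 0 ≤ x * τ := by positivity
  have hα2 : (x * τ) ^ 2 = μ * (r * τ ^ 2) := by
    rw [mul_pow, hx2]
    ring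
  set α := x * τ
  have h1 : α ^ 2 * μ ≤ 1 / 10 ^ 4 := by
    calc α ^ 2 * μ = μ ^ 2 * (r * τ ^ 2) := by rw [hα2]; ring
      _ ≤ M * (r * τ ^ 2) := by
        gcongr
        exact le_max_left _ _
      _ ≤ _ := h
  have h2 : α ^ 2 * (r * w) ≤ 1 / 10 ^ 4 := by
    calc α ^ 2 * (r * w) = w ^ 4 * r * (r * τ ^ 2) := by rw [hα2, ← hw3]; ring
      _ ≤ M * (r * τ ^ 2) := by
        gcongr
        exact (le_max_left _ _).trans (le_max_right _ _)
      _ ≤ _ := h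
  have h3 : α ^ 2 * z ≤ 1 / 10 ^ 4 := by
    calc α ^ 2 * z = μ * z * (r * τ ^ 2) := by rw [hα2]; ring
      _ ≤ M * (r * τ ^ 2) := by
        gcongr
        exact (le_max_right _ _).trans (le_max_right _ _)
      _ ≤ _ := h
  have hw0 : 0 < w := by linarith
  have h4 : α ^ 2 * r ≤ 1 / 10 ^ 4 := le_trans (by
    gcongr
    exact le_mul_of_one_le_right (by linarith) hw1) h2
  have h5 : α ^ 2 * w ≤ 1 / 10 ^ 4 := le_trans (by
    gcongr
    exact le_mul_of_one_le_left hw0.le hr) h2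
  refine ⟨le_trans (le_mul_of_one_le_right (by positivity) hμ) h1, ?_, ?_, ?_⟩
  · refine abs_le_of_sq_le_sq' ?_ (by norm_num) |>.2
    calc (α ^ 2 * x) ^ 2 = (α ^ 2 * μ) * (α ^ 2 * r) := by rw [mul_pow, hx2]; ring
      _ ≤ 1 / 10 ^ 4 * (1 / 10 ^ 4) := by gcongr
      _ = _ := by norm_num
  · refine abs_le_of_sq_le_sq' ?_ (by norm_num) |>.2
    calc (α ^ 3 * x * s) ^ 2 = (α ^ 2 * (r * w)) ^ 2 * (α ^ 2 * w) := by
          rw [mul_pow, mul_pow, hx2, hs2, ← hw3]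
          ring
      _ ≤ (1 / 10 ^ 4) ^ 2 * (1 / 10 ^ 4) := by gcongr
      _ ≤ _ := by norm_num
  · rw [hzsq]
    calc α ^ 4 * z ^ 2 = (α ^ 2 * z) ^ 2 := by ring
      _ ≤ (1 / 10 ^ 4) ^ 2 := by gcongr
      _ = _ := by norm_num

variable {m n r : ℕ} {U : Matrix (Fin m) (Fin r) ℝ} {V : Matrix (Fin n) (Fin r) ℝ}

/-- The event whose probability the main theorem bounds from below. -/
def CertificateEvent (U : Matrix (Fin m) (Fin r) ℝ) (V : Matrix (Fin n) (Fin r) ℝ)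
    (Ω : Finset (Fin m × Fin n)) : Prop :=
  Set.BijOn (fun X => PT U V (PΩ Ω (PT U V X))) {M | memT U V M} {M | memT U V M} ∧
    ∀ F : Matrix (Fin m) (Fin n) ℝ, memT U V F → PT U V (PΩ Ω (PT U V F)) = U * Vᵀ →
      specNorm (PTperp U V (PΩ Ω (PT U V F))) < 1

theorem certificateEvent_of_isEmpty [IsEmpty (Fin r)] (Ω : Finset (Fin m × Fin n)) :
    CertificateEvent U V Ω := by
  have hPT : ∀ X, PT U V X = 0 := fun X => by
    ext i j
    simp [PT, Matrix.mul_apply]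
  have hmem : {M | memT U V M} = {0} := by
    ext M
    constructor
    · rintro ⟨X, Y, rfl⟩
      ext i j
      simp [Matrix.mul_apply]
    · rintro rfl
      exact ⟨0, 0, by simp⟩
  refine ⟨?_, fun F _ _ => ?_⟩
  · rw [hmem]
    simp [hPT]
  · have h0 : PTperp U V (PΩ Ω (PT U V F)) = 0 := by
      rw [hPT]
      ext i j
      simp [PTperp, PΩ, Matrix.mul_apply]
    rw [h0]
    refine (specNorm_le (s := 0) ?_ le_rfl).trans_lt one_pos
    intro x y
    simp

theorem GoodPattern.certificateEvent (hU : Uᵀ * U = 1) (hV : Vᵀ * V = 1) {ν : ℝ} (hν : 1 ≤ ν)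
    (hUν : ∀ i, ∑ k, U i k ^ 2 ≤ ν / m) (hVν : ∀ j, ∑ k, V j k ^ 2 ≤ ν / n)
    {p : ℝ} (h0 : 0 < p) (hm : 0 < m) (hn : 0 < n) {τ N : ℝ} (hτ0 : 0 ≤ τ) (hN : 0 ≤ N)
    (hpN : 1 ≤ p * (τ ^ 2 * N)) (hrν : r ≤ ν)
    (hα2 : (√ν * τ) ^ 2 ≤ 1 / 10 ^ 4) (hαx : (√ν * τ) ^ 2 * √ν ≤ 1 / 10 ^ 4)
    (hαxs : (√ν * τ) ^ 3 * √ν * √r ≤ 1 / 10 ^ 4) (hαN : (√ν * τ) ^ 4 * √N ≤ 1 / 10 ^ 8)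
    {Ω : Finset (Fin m × Fin n)}
    (h : GoodPattern U V (samplePattern p Ω)
      (9 * (√ν * τ)) (13 * τ * √(m * n)) (26 * (√ν * τ)) (4 * (√ν * τ) * √(ν / (m * n)))) :
    CertificateEvent U V Ω := by
  have hm' : (0 : ℝ) < m := by exact_mod_cast hm
  have hn' : (0 : ℝ) < n := by exact_mod_cast hn
  have hν0 : 0 < ν := by linarith
  have hα0 : 0 ≤ √ν * τ := by positivity
  have hα : √ν * τ ≤ 1 / 100 := by
    refine abs_le_of_sq_le_sq' (hα2.trans ?_) (by norm_num) |>.2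
    norm_num
  have hsm : √(m : ℝ) ≠ 0 := (Real.sqrt_pos.2 hm').ne'
  have hsn : √(n : ℝ) ≠ 0 := (Real.sqrt_pos.2 hn').ne'
  constructor
  · have := h.restricted.bijOn hU hV (by positivity) (by linarith) h0
    simpa only [PΩ_eq_smul h0.ne'] using this
  · intro F hF hFE
    rw [(memT_iff hU hV F).1 hF] at hFE ⊢
    have hG : PΩ Ω F = p • F + samplePattern p Ω ⊙ (p • F) := by
      rw [PΩ_eq_smul h0.ne', smul_add, hadamard_smul]
    rw [hG] at hFE ⊢
    have hrow : ∀ {k : ℕ} (W : Matrix (Fin k) (Fin r) ℝ) (i : Fin k),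
        W i ⬝ᵥ W i = ∑ l, W i l ^ 2 := fun W i => by simp [dotProduct, pow_two]
    have key := h.specLE_PTperp (u := √ν / √m) (v := √ν / √n) (s := √r) hU hV (by positivity)
      (by linarith)
      (by positivity) (by positivity) (by positivity) (by positivity) (by positivity) h0
      (fun i j => neg_one_le_berDev h0.le Ω (i, j)) (fun i j => one_add_berDev_sq p Ω (i, j))
      (frobNorm_mul_transpose_le hU hV)
      (fun i => by
        rw [hrow, ← Real.sqrt_div hν0.le]
        exact Real.sqrt_le_sqrt (hUν i))
      (fun j => by
        rw [hrow, ← Real.sqrt_div hν0.le]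
        exact Real.sqrt_le_sqrt (hVν j))
      (G := p • F) (by rw [PT_smul, (memT_iff hU hV F).1 hF]) hFE
    refine (specNorm_le key (by positivity)).trans_lt ?_
    refine certificate_bound_lt_one (x := √ν) hα0 rfl rfl ?_ ?_ ?_ ?_ hα2 hαx hαxs ?_
    · rw [Real.sqrt_div hν0.le]
      have : √((m : ℝ) * n) ≠ 0 := (Real.sqrt_pos.2 (by positivity)).ne'
      field_simp
      ring
    · rw [Real.sqrt_mul hm'.le]
      field_simp
    · field_simp
    · field_simp
    · have hp2 : √(2 / p) ≤ 2 * (τ * √N) := by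
        refine Real.sqrt_le_iff.2 ⟨by positivity, ?_⟩
        rw [div_le_iff₀ h0, mul_pow, mul_pow, Real.sq_sqrt hN]
        nlinarith
      have hsx : √(r : ℝ) ≤ √ν := Real.sqrt_le_sqrt hrν
      calc √(2 / p) * ((9 * (√ν * τ)) ^ 3 * (2 * √r))
          ≤ 2 * (τ * √N) * ((9 * (√ν * τ)) ^ 3 * (2 * √ν)) := by gcongr
        _ = 2916 * ((√ν * τ) ^ 4 * √N) := by ring
        _ ≤ 2916 * (1 / 10 ^ 8) := by gcongr
        _ ≤ 1 / 10 := by norm_num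

theorem sum_sum_sq_eq_of_transpose_mul_self (hU : Uᵀ * U = 1) : ∑ i, ∑ k, U i k ^ 2 = r := by
  have := congrArg Matrix.trace hU
  rw [trace_one, Fintype.card_fin] at this
  rw [← this, Finset.sum_comm]
  simp [Matrix.trace, Matrix.mul_apply, pow_two]

theorem pos_of_transpose_mul_self (hU : Uᵀ * U = 1) (hr : 0 < r) : 0 < m := by
  rcases Nat.eq_zero_or_pos m with rfl | h
  · have := sum_sum_sq_eq_of_transpose_mul_self hU
    rw [Finset.univ_eq_empty, Finset.sum_empty] at this
    exact absurd this.symm (by exact_mod_cast hr.ne')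
  · exact h

theorem one_le_of_incoherent (hU : Uᵀ * U = 1) (hr : 0 < r) {μ : ℝ}
    (hμ : ∀ i, ∑ k, U i k ^ 2 ≤ μ * r / m) : 1 ≤ μ := by
  have hm : (0 : ℝ) < m := by exact_mod_cast pos_of_transpose_mul_self hU hr
  have hr' : (0 : ℝ) < r := by exact_mod_cast hr
  have h := Finset.sum_le_sum fun i (_ : i ∈ Finset.univ) => hμ i
  rw [sum_sum_sq_eq_of_transpose_mul_self hU, Finset.sum_const, Finset.card_univ, Fintype.card_fin,
    nsmul_eq_mul, mul_div_cancel₀ _ hm.ne'] at h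
  nlinarith

end Conclusion

theorem mc_dual_certificate_size_property :
    ∃ c > (0:ℝ), ∃ c₀ > (0:ℝ),
      ∀ (n₁ n₂ r : ℕ) (β μ : ℝ), 2 ≤ β → 0 < μ →
      ∀ (U : Matrix (Fin n₁) (Fin r) ℝ) (V : Matrix (Fin n₂) (Fin r) ℝ),
        Uᵀ * U = 1 → Vᵀ * V = 1 → IncoherentUV U V μ →
      ∀ p : ℝ, 0 ≤ p → p ≤ 1 →
        c₀ * max (μ ^ 2) (max (μ ^ ((4:ℝ)/3) * (r : ℝ))
            (μ * ((max n₁ n₂ : ℕ) : ℝ) ^ ((1:ℝ)/4))) *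
          ((max n₁ n₂ : ℕ) : ℝ) * (r : ℝ) * β * Real.log ((max n₁ n₂ : ℕ) : ℝ) ≤
          p * (n₁ : ℝ) * (n₂ : ℝ) →
        berProb n₁ n₂ p (fun Ω =>
            Set.BijOn (fun X => PT U V (PΩ Ω (PT U V X)))
              {M | memT U V M} {M | memT U V M} ∧
            ∀ F : Matrix (Fin n₁) (Fin n₂) ℝ, memT U V F →
              PT U V (PΩ Ω (PT U V F)) = U * Vᵀ →
              specNorm (PTperp U V (PΩ Ω (PT U V F))) < 1)
          ≥ 1 - c * ((max n₁ n₂ : ℕ) : ℝ) ^ (-β) := by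
  refine ⟨8, by norm_num, 20000, by norm_num, ?_⟩
  intro n₁ n₂ r β μ hβ hμ0 U V hU hV hinc p hp0 hp1 hsize
  rw [berProb_eq_berPr, ge_iff_le]
  change _ ≤ berPr p (CertificateEvent U V)
  set N : ℝ := ((max n₁ n₂ : ℕ) : ℝ) with hNdef
  have hNβ : 0 ≤ N ^ (-β) := Real.rpow_nonneg (Nat.cast_nonneg _) _
  obtain rfl | hr := Nat.eq_zero_or_pos r
  · have h1 : berPr p (CertificateEvent U V) = 1 := by
      simp only [berPr, certificateEvent_of_isEmpty, if_true]
      exact berExp_const p 1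
    linarith
  have hn₁ := pos_of_transpose_mul_self hU hr
  have hn₂ := pos_of_transpose_mul_self hV hr
  have hn₁' : (0 : ℝ) < n₁ := by exact_mod_cast hn₁
  have hn₂' : (0 : ℝ) < n₂ := by exact_mod_cast hn₂
  have hr' : (1 : ℝ) ≤ r := by exact_mod_cast hr
  have hμ := one_le_of_incoherent hU hr hinc.1
  have hn₁N : (n₁ : ℝ) ≤ N := by
    rw [hNdef]
    exact_mod_cast le_max_left _ _
  have hn₂N : (n₂ : ℝ) ≤ N := by
    rw [hNdef]
    exact_mod_cast le_max_right _ _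
  obtain hN1 | hN2 : max n₁ n₂ ≤ 1 ∨ 2 ≤ max n₁ n₂ := by omega
  · have hN : N = 1 := by
      have : max n₁ n₂ = 1 := by omega
      rw [hNdef, this, Nat.cast_one]
    have h1 : 0 ≤ berPr p (CertificateEvent U V) := by
      rw [← berExp_const (ι := Fin n₁ × Fin n₂) p 0]
      exact berExp_mono hp0 hp1 fun Ω => by split_ifs <;> norm_num
    rw [hN, Real.one_rpow]
    linarith
  have hN2' : (2 : ℝ) ≤ N := by
    rw [hNdef]
    exact_mod_cast hN2
  have hN0 : 0 < N := by linarith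
  set L := Real.log N with hL
  have hL2 : 0.69 < L :=
    lt_of_lt_of_le (by linarith [Real.log_two_gt_d9]) (Real.log_le_log two_pos hN2')
  have hβL : 1 ≤ β * L := by nlinarith
  set q := ⌈β * L⌉₊ with hqdef
  have hq : q ≠ 0 := (Nat.ceil_pos.2 (by linarith)).ne'
  have hq1 : (1 : ℝ) ≤ q := by exact_mod_cast Nat.one_le_iff_ne_zero.2 hq
  have hqle : β * L ≤ q := Nat.le_ceil _
  have hq2 : (q : ℝ) ≤ 2 * (β * L) := by linarith [Nat.ceil_lt_add_one (show 0 ≤ β * L by linarith)]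
  set M := max (μ ^ 2) (max (μ ^ ((4 : ℝ) / 3) * (r : ℝ)) (μ * N ^ ((1 : ℝ) / 4))) with hM
  have hM0 : 0 < M := lt_of_lt_of_le (by positivity) (le_max_left _ _)
  have hsize' : 20000 * (M * r * N * (β * L)) ≤ p * (n₁ * n₂) := by linarith
  have hp : 0 < p := by
    refine pos_of_mul_pos_left (b := (n₁ : ℝ) * n₂) (lt_of_lt_of_le ?_ hsize') (by positivity)
    positivity
  have hpD : 0 < p * ((n₁ : ℝ) * n₂) := by positivity
  set τ := √(q * N / (p * (n₁ * n₂))) with hτdef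
  have hτ2 : τ ^ 2 = q * N / (p * (n₁ * n₂)) := Real.sq_sqrt (by positivity)
  have hτ : τ ^ 2 * (p * (n₁ * n₂)) = q * N := by
    rw [hτ2]
    field_simp
  have hτ0 : 0 ≤ τ := Real.sqrt_nonneg _
  have hMτ : M * r * τ ^ 2 ≤ 1 / 10 ^ 4 := by
    rw [hτ2, ← mul_div_assoc, div_le_iff₀ hpD]
    have : M * r * (q * N) ≤ M * r * (2 * (β * L) * N) := by gcongr
    linarith
  obtain ⟨hα2, hαx, hαxs, hαN⟩ := certificate_scalar_bounds hμ hr' (by linarith) hτ0 hMτ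
  have hν : 1 ≤ μ * r := one_le_mul_of_one_le_of_one_le hμ hr'
  have hpN : 1 ≤ p * (τ ^ 2 * N) := by
    have h1 : N ≤ q * N := le_mul_of_one_le_left hN0.le hq1
    have h2 : τ ^ 2 * (p * (n₁ * n₂)) ≤ τ ^ 2 * (p * (N * N)) := by gcongr
    have h3 : 1 * N ≤ p * (τ ^ 2 * N) * N := by linarith
    exact le_of_mul_le_mul_right h3 hN0
  have hbad := berPr_not_goodPattern_le hU hV hν hinc.1 hinc.2.1 hinc.2.2 hp hp1 hn₁ hn₂ hn₁N hn₂N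
    hN2' hq hτ0 hτ (by
      rw [mul_pow, Real.sq_sqrt (by positivity)] at hα2
      exact hα2.trans (by norm_num))
  have hgood := berPr_mono hp.le hp1 fun (Ω : Finset (Fin n₁ × Fin n₂)) (h : GoodPattern U V
      (samplePattern p Ω) _ _ _ _) => h.certificateEvent hU hV hν hinc.1 hinc.2.1 hp hn₁ hn₂ hτ0
    hN0.le hpN (le_mul_of_one_le_left (by linarith) hμ) hα2 hαx hαxs hαN
  rw [berPr_compl] at hgood
  have hexp : N ^ 2 * Real.exp (-(2 * q)) ≤ N ^ (-β) := by
    rw [Real.rpow_def_of_pos hN0, ← hL, ← Real.exp_log (pow_pos hN0 2), Real.log_pow, ← hL,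
      ← Real.exp_add, Real.exp_le_exp]
    push_cast
    nlinarith
  linarith
end
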